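/- arXiv:1908.03644 — 2 statements merged into one kernel-verified Lean document; each statement's English description precedes it below -/
import Mathlib

section
/- Golubev's theorem: let P, Q ∈ ℂ[z][w] be polynomials in w with polynomial coefficients in z, Q ≠ 0, and P, Q coprime as polynomials in w over ℂ(z). If the equation w′·Q(z,w) = P(z,w) has three pairwise distinct rational solutions w₁, w₂, w₃ (rational functions of z satisfying w_k′(z)·Q(z, w_k(z)) = P(z, w_k(z)) for all z at which w_k is analytic), then every single-valued solution of the ODE w′·Q(z,w) = P(z,w) is a rational function. -/
/-- Evaluation of `P ∈ ℂ[z][w]` (a polynomial in `w` whose coefficients are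
polynomials in `z`) at the point `(z, w)`. -/
noncomputable def evZW (P : Polynomial (Polynomial ℂ)) (z w : ℂ) : ℂ :=
  (P.map (Polynomial.evalRingHom z)).eval w

/-- The rational function `A / B` is a solution of the ODE `w' · Q(z, w) = P(z, w)`:
at every point where `B` does not vanish (hence `A / B` is analytic), the equation
holds. -/
noncomputable def IsRatSolution (P Q : Polynomial (Polynomial ℂ))
    (A B : Polynomial ℂ) : Prop :=
  B ≠ 0 ∧ ∀ z : ℂ, B.eval z ≠ 0 →
    deriv (fun x => A.eval x / B.eval x) z * evZW Q z (A.eval z / B.eval z) =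
      evZW P z (A.eval z / B.eval z)

section golubevHelpers

open Complex Metric Real Filter Topology


/-- derivative estimate through mean of positive part of real part -/
lemma deriv_bound (g : ℂ → ℂ) (hg : Differentiable ℂ g) (R : ℝ) (z : ℂ) (hz : ‖z‖ < R) :
    ‖deriv g z‖ ≤ 2 * R / (R - ‖z‖) ^ 2 *
      (2 * circleAverage (fun x => max (g x).re 0) 0 R + ‖g 0‖) := by
  have hR : 0 < R := lt_of_le_of_lt (norm_nonneg _) hz
  have hgc := hg.continuous
  let u : ℂ → ℝ := fun x => (g x).re
  have huc : Continuous u := by fun_prop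
  have hci : ∀ {f : ℂ → ℝ}, Continuous f → CircleIntegrable f 0 R := fun hf =>
    hf.continuousOn.circleIntegrable'
  have hzb : z ∈ ball (0 : ℂ) R := by simpa using hz
  let H : ℂ → ℂ := fun w => circleAverage (fun ζ ↦ herglotzRieszKernel 0 w ζ • (u ζ : ℂ)) 0 R
  have huI : CircleIntegrable (fun ζ => (u ζ : ℂ)) 0 R :=
    Continuous.continuousOn (by fun_prop) |>.circleIntegrable'
  have hH : HasDerivAt H (circleAverage (fun ζ ↦ (2 * ζ / (ζ - z) ^ 2) • (u ζ : ℂ)) 0 R) z :=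
    hasDerivAt_circleAverage_herglotzRieszKernel_smul huI hzb
  have hre : ∀ w ∈ ball (0 : ℂ) R, (g w - H w).re = 0 := by
    intro w hw
    have h1 : (H w).re = _ := re_circleAverage_herglotzRieszKernel_smul (hci huc) hw
    have h2 : circleAverage ((Complex.re ∘ herglotzRieszKernel 0 w) • u) 0 R = u w := by
      apply InnerProductSpace.HarmonicOnNhd.circleAverage_re_herglotzRieszKernel_smul _ hw
      intro x hx
      exact (hg.analyticAt x).harmonicAt_re
    rw [Complex.sub_re, h1, h2]; simp [u]
  have hd : deriv g z = circleAverage (fun ζ ↦ (2 * ζ / (ζ - z) ^ 2) • (u ζ : ℂ)) 0 R := by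
    have hF : HasDerivAt (fun w => g w - H w) _ z := (hg z).hasDerivAt.sub hH
    set c := deriv g z - circleAverage (fun ζ ↦ (2 * ζ / (ζ - z) ^ 2) • (u ζ : ℂ)) 0 R with hc
    have key : ∀ d : ℂ, (c * d).re = 0 := by
      intro d
      have hl : HasDerivAt (fun t : ℝ => z + (t : ℂ) * d) d 0 := by
        have : HasDerivAt (fun t : ℝ => (t : ℂ)) 1 (0:ℝ) := Complex.ofRealCLM.hasDerivAt
        simpa using (this.mul_const d).const_add z
      have hF' : HasDerivAt (fun w => g w - H w) c (z + ((0:ℝ) : ℂ) * d) := by simpa using hF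
      have h3 := HasDerivAt.comp (0:ℝ) hF' hl
      have h4 : HasDerivAt (fun t : ℝ => (g (z + (t:ℂ) * d) - H (z + (t:ℂ) * d)).re) (c * d).re 0 :=
        Complex.reCLM.hasFDerivAt.comp_hasDerivAt (0:ℝ) h3
      have h5 : (fun t : ℝ => (g (z + (t:ℂ) * d) - H (z + (t:ℂ) * d)).re) =ᶠ[𝓝 0] fun _ => 0 := by
        have hcont : ContinuousAt (fun t : ℝ => z + (t : ℂ) * d) 0 := hl.continuousAt
        have : ∀ᶠ t : ℝ in 𝓝 (0:ℝ), z + (t : ℂ) * d ∈ ball (0:ℂ) R := by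
          apply hcont.eventually_mem
          simpa using isOpen_ball.mem_nhds hzb
        filter_upwards [this] with t ht using hre _ ht
      have h6 := (hasDerivAt_const (0:ℝ) (0:ℝ)).congr_of_eventuallyEq h5
      exact h4.unique h6
    have c0 : c = 0 := by
      apply Complex.ext
      · simpa using key 1
      · simpa using key I
    exact sub_eq_zero.1 (hc ▸ c0)
  have habs : circleAverage (fun x => |u x|) 0 R ≤
      2 * circleAverage (fun x => max (g x).re 0) 0 R + ‖g 0‖ := by
    have e1 : (fun x => |u x|) = (fun x => (2:ℝ) • max (g x).re 0 - u x) := by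
      funext x
      rcases le_total 0 (u x) with h | h
      · rw [abs_of_nonneg h, max_eq_left h]; simp only [u, smul_eq_mul]; ring
      · rw [abs_of_nonpos h, max_eq_right h]; simp
    have e2 : circleAverage u 0 R = u 0 := by
      apply InnerProductSpace.HarmonicOnNhd.circleAverage_eq
      intro x hx
      exact (hg.analyticAt x).harmonicAt_re
    rw [e1, circleAverage_fun_sub (hci (by fun_prop)) (hci huc), circleAverage_fun_smul, e2]
    have : |u 0| ≤ ‖g 0‖ := Complex.abs_re_le_norm _
    have := neg_abs_le (u 0)
    simp only [smul_eq_mul]; linarith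
  have hzR : 0 < R - ‖z‖ := by linarith
  have hbd : ‖deriv g z‖ ≤ 2 * R / (R - ‖z‖) ^ 2 * circleAverage (fun x => |u x|) 0 R := by
    rw [hd]
    rw [circleAverage_def, circleAverage_def, norm_smul, smul_eq_mul, ← mul_assoc,
      mul_comm (2 * R / (R - ‖z‖) ^ 2), mul_assoc]
    have : ‖(2 * π)⁻¹‖ = (2 * π)⁻¹ := Real.norm_of_nonneg (by positivity)
    rw [this]
    gcongr
    rw [← intervalIntegral.integral_const_mul]
    apply intervalIntegral.norm_integral_le_of_norm_le (by positivity)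
    · refine Filter.Eventually.of_forall fun t _ => ?_
      have hn : ‖circleMap 0 R t‖ = R := by simp [abs_of_pos hR]
      have hge : R - ‖z‖ ≤ ‖circleMap 0 R t - z‖ := by
        have := norm_sub_norm_le (circleMap 0 R t) z
        rwa [hn] at this
      rw [norm_smul, norm_div, norm_mul, norm_pow, hn]
      simp only [Complex.norm_ofNat, Complex.norm_real, Real.norm_eq_abs]
      gcongr
    · exact Continuous.intervalIntegrable (by fun_prop) _ _
  exact hbd.trans (by gcongr)

lemma jensen_lower (D : ℂ → ℂ) (hD : Differentiable ℂ D) :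
    ∃ c : ℝ, ∀ r : ℝ, 1 ≤ r → c ≤ circleAverage (fun x => Real.log ‖D x‖) 0 r := by
  refine ⟨Real.log ‖meromorphicTrailingCoeffAt D 0‖, fun r hr => ?_⟩
  have hr0 : r ≠ 0 := by positivity
  have hA : AnalyticOnNhd ℂ D (closedBall 0 |r|) := fun x _ => hD.analyticAt x
  rw [MeromorphicOn.circleAverage_log_norm hr0 hA.meromorphicOn]
  have hnn : 0 ≤ MeromorphicOn.divisor D (closedBall 0 |r|) :=
    MeromorphicOn.AnalyticOnNhd.divisor_nonneg hA
  have h1 : 0 ≤ ∑ᶠ u, (MeromorphicOn.divisor D (closedBall 0 |r|) u : ℝ) * Real.log (r * ‖0 - u‖⁻¹) := by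
    apply finsum_nonneg
    intro u
    by_cases hu : u ∈ closedBall (0:ℂ) |r|
    · apply mul_nonneg
      · exact_mod_cast hnn u
      · by_cases hu0 : u = 0
        · simp [hu0]
        apply Real.log_nonneg
        rw [abs_of_pos (by positivity)] at hu
        have : 0 < ‖u‖ := norm_pos_iff.2 hu0
        rw [zero_sub, norm_neg, ← div_eq_mul_inv, one_le_div this]
        simpa using hu
    · simp [hu]
  have h2 : 0 ≤ (MeromorphicOn.divisor D (closedBall 0 |r|) 0 : ℝ) * Real.log r :=
    mul_nonneg (by exact_mod_cast hnn 0) (Real.log_nonneg hr)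
  linarith

/-- growth lemma -/
lemma growth (T : ℝ → ℝ) (hT : Continuous T) (hT0 : ∀ r, 0 ≤ T r) (K : ℝ) (hK : 1 ≤ K)
    (h : ∀ r R, 1 ≤ r → r < R → T r ≤ K * (1 + Real.log R + Real.log (1 + T R)
      + Real.log (1 + 1 / (R - r)))) :
    ∃ L : ℝ, 0 ≤ L ∧ ∀ r, 1 ≤ r → T r ≤ L * (1 + Real.log r) := by
  set K1 : ℝ := 6 * K with hK1
  set lam : ℝ := 24 * K1 with hlam
  set L : ℝ := K1 * (lam + 1) with hL
  refine ⟨L, by positivity, fun r hr => ?_⟩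
  by_contra hcon
  push Not at hcon
  have hlr : 0 ≤ Real.log r := Real.log_nonneg hr
  let ρ : ℕ → ℝ := fun n => r + 2 - 2 * (1/2 : ℝ) ^ n
  have hρ1 : ∀ n, r ≤ ρ n := fun n => by
    have : (1/2 : ℝ) ^ n ≤ 1 := pow_le_one₀ (by norm_num) (by norm_num)
    simp only [ρ]; linarith
  have hρ2 : ∀ n, ρ n ≤ r + 2 := fun n => by
    have : 0 < (1/2 : ℝ) ^ n := by positivity
    simp only [ρ]; linarith
  have hρd : ∀ n, ρ (n+1) - ρ n = (1/2 : ℝ)^n := fun n => by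
    simp only [ρ, pow_succ]; ring
  have key : ∀ n : ℕ, L * (1 + Real.log r + n) ≤ 1 + T (ρ n) := by
    intro n
    induction n with
    | zero => simp [ρ]; linarith
    | succ n ih =>
      have hstep := h (ρ n) (ρ (n+1)) (hr.trans (hρ1 n))
        (by have := hρd n; have : 0 < (1/2 : ℝ) ^ n := by positivity
            linarith)
      have hl1 : Real.log (ρ (n+1)) ≤ 2 + Real.log r := by
        have : ρ (n+1) ≤ 3 * r := by have := hρ2 (n+1); linarith
        calc Real.log (ρ (n+1)) ≤ Real.log (3 * r) :=
              Real.log_le_log (by linarith [hρ1 (n+1)]) this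
          _ = Real.log 3 + Real.log r := Real.log_mul (by norm_num) (by positivity)
          _ ≤ 2 + Real.log r := by
              have := Real.log_le_sub_one_of_pos (x := 3) (by norm_num)
              linarith
      have hl2 : Real.log (1 + 1 / (ρ (n+1) - ρ n)) ≤ n + 1 := by
        rw [hρd n]
        have e : 1 / (1/2 : ℝ)^n = 2 ^ n := by simp
        rw [e]
        have h1 : (1:ℝ) ≤ 2 ^ n := one_le_pow₀ (by norm_num)
        calc Real.log (1 + 2^n) ≤ Real.log (2 ^ (n+1)) :=
              Real.log_le_log (by positivity) (by rw [pow_succ]; linarith)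
          _ = (n+1) * Real.log 2 := by rw [Real.log_pow]; push_cast; ring
          _ ≤ (n + 1) * 1 := by
              gcongr; have := Real.log_two_lt_d9; linarith
          _ = n + 1 := by ring
      set s : ℝ := 1 + Real.log r + n with hs
      have hs1 : 1 ≤ s := by have : (0:ℝ) ≤ n := by positivity
                             linarith
      set X : ℝ := 1 + T (ρ (n+1)) with hX
      have hX1 : 1 ≤ X := by have := hT0 (ρ (n+1)); linarith
      have hlX : 0 ≤ Real.log X := Real.log_nonneg hX1
      have h1 : 1 + T (ρ n) ≤ K1 * (s + Real.log X) := by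
        have : K * (1 + Real.log (ρ (n+1)) + Real.log X + Real.log (1 + 1 / (ρ (n+1) - ρ n)))
            ≤ K * (4 * s + Real.log X) := by
          apply mul_le_mul_of_nonneg_left _ (by positivity)
          have : (0:ℝ) ≤ n := by positivity
          linarith
        rw [hK1]
        nlinarith
      have h2 : lam * s ≤ Real.log X := by
        have : K1 * (lam * s) ≤ K1 * Real.log X := by
          have := ih.trans h1
          rw [hL] at this
          linarith
        exact le_of_mul_le_mul_left this (by positivity)
      have h3 : Real.exp (lam * s) ≤ X := (Real.le_log_iff_exp_le (by positivity)).1 h2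
      have hlam24 : 24 ≤ lam := by rw [hlam, hK1]; linarith
      have h4 : (lam * s) ^ 2 / 2 ≤ Real.exp (lam * s) := by
        have := Real.quadratic_le_exp_of_nonneg (x := lam * s) (by positivity)
        have : 0 ≤ lam * s := by positivity
        linarith
      have h5 : L * (s + 1) ≤ (lam * s) ^ 2 / 2 := by
        have hK1' : K1 = lam / 24 := by rw [hlam]; ring
        rw [hL, hK1']
        have a1 : (lam + 1) * (s + 1) ≤ (2 * lam) * (2 * s) := by gcongr <;> linarith
        have a2 : s ≤ s ^ 2 := by nlinarith
        have a3 : lam ^ 2 * s ≤ lam ^ 2 * s ^ 2 := by gcongr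
        nlinarith
      have : (1 + Real.log r + ((n+1 : ℕ) : ℝ)) = s + 1 := by rw [hs]; push_cast; ring
      rw [this]
      linarith
  obtain ⟨M, hM⟩ := (isCompact_Icc (a := r) (b := r+2)).bddAbove_image hT.continuousOn
  have hLpos : 0 < L := by positivity
  obtain ⟨n, hn⟩ := exists_nat_gt ((1 + M) / L)
  have h1 := key n
  have h2 : T (ρ n) ≤ M := hM ⟨ρ n, ⟨hρ1 n, hρ2 n⟩, rfl⟩
  rw [div_lt_iff₀ hLpos] at hn
  nlinarith
lemma polybd (s : Finset (Polynomial ℂ)) : ∃ A : ℝ, 1 ≤ A ∧ ∃ n : ℕ, ∀ p ∈ s, ∀ z : ℂ, 1 ≤ ‖z‖ →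
    ‖p.eval z‖ ≤ A * ‖z‖ ^ n := by
  induction s using Finset.induction_on with
  | empty => exact ⟨1, le_rfl, 0, by simp⟩
  | insert p s _ ih =>
    obtain ⟨A, hA, n, h⟩ := ih
    let S : ℝ := ∑ i ∈ Finset.range (p.natDegree + 1), ‖p.coeff i‖
    have hS : 0 ≤ S := by positivity
    refine ⟨A + S, by linarith, n + p.natDegree, fun q hq z hz => ?_⟩
    rcases Finset.mem_insert.1 hq with rfl | hq
    · rw [Polynomial.eval_eq_sum_range]
      calc _ ≤ ∑ i ∈ Finset.range (q.natDegree + 1), ‖q.coeff i * z ^ i‖ := norm_sum_le _ _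
        _ ≤ ∑ i ∈ Finset.range (q.natDegree + 1), ‖q.coeff i‖ * ‖z‖ ^ (n + q.natDegree) := by
          apply Finset.sum_le_sum
          intro i hi
          rw [norm_mul, norm_pow]
          gcongr
          have := Finset.mem_range.1 hi; omega
        _ = S * ‖z‖ ^ (n + q.natDegree) := by rw [← Finset.sum_mul]
        _ ≤ _ := by gcongr; linarith
    · refine (h q hq z hz).trans ?_
      gcongr
      · linarith
      · omega

lemma mean_bound (g D N : ℂ → ℂ) (hg : Differentiable ℂ g) (hD : Differentiable ℂ D)
    (hD0 : ∃ z, D z ≠ 0) (h : ∀ z, Complex.exp (g z) * D z = N z) :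
    ∃ C : ℝ, ∀ r : ℝ, 1 ≤ r → ∀ M : ℝ, 1 ≤ M →
      (∀ z, ‖z‖ = r → ‖N z‖ ≤ M ∧ ‖D z‖ ≤ M) →
      circleAverage (fun x => max (g x).re 0) 0 r ≤ Real.log M + C := by
  classical
  obtain ⟨c, hc⟩ := jensen_lower D hD
  refine ⟨-c, fun r hr M hM hb => ?_⟩
  have hr0 : r ≠ 0 := by positivity
  have hgc := hg.continuous
  let f1 : ℂ → ℝ := fun x => max (g x).re 0
  let f2 : ℂ → ℝ := fun x => if D x = 0 then 0 else max (g x).re 0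
  have hA : AnalyticOnNhd ℂ D Set.univ := fun x _ => hD.analyticAt x
  have hcod : {x | D x ≠ 0} ∈ codiscreteWithin (sphere (0:ℂ) |r|) := by
    obtain ⟨z0, hz0⟩ := hD0
    have := hA.preimage_zero_mem_codiscreteWithin (x := z0) hz0 (Set.mem_univ _) isConnected_univ
    have h2 := Filter.codiscreteWithin_mono (Set.subset_univ (sphere (0:ℂ) |r|)) this
    filter_upwards [h2] with x hx
    simpa using hx
  have heq : f1 =ᶠ[codiscreteWithin (sphere (0:ℂ) |r|)] f2 := by
    filter_upwards [hcod] with x hx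
    have : D x ≠ 0 := hx
    simp [f1, f2, this]
  have hf1 : CircleIntegrable f1 0 r := Continuous.continuousOn (by fun_prop) |>.circleIntegrable'
  have hf2 : CircleIntegrable f2 0 r := hf1.congr_codiscreteWithin heq
  have hlog : CircleIntegrable (fun x => Real.log ‖D x‖) 0 r :=
    MeromorphicOn.circleIntegrable_log_norm (fun x _ => (hD.analyticAt x).meromorphicAt)
  have hconst : CircleIntegrable (fun _ => Real.log M) (0:ℂ) r :=
    Continuous.continuousOn (by fun_prop) |>.circleIntegrable'
  have h1 : circleAverage f1 0 r = circleAverage f2 0 r :=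
    circleAverage_congr_codiscreteWithin heq hr0
  have h2 : circleAverage f2 0 r ≤ circleAverage (fun x => Real.log M - Real.log ‖D x‖) 0 r := by
    apply circleAverage_mono hf2 (hconst.sub hlog)
    intro x hx
    have hx' : ‖x‖ = r := by
      have : ‖x‖ = |r| := by simpa using hx
      rw [this, abs_of_nonneg (by linarith)]
    obtain ⟨hN, hDM⟩ := hb x hx'
    rw [Pi.sub_apply]
    by_cases h0 : D x = 0
    · simp [f2, h0, Real.log_nonneg hM]
    · simp only [f2, h0, if_false]
      have hpos : 0 < ‖D x‖ := norm_pos_iff.2 h0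
      apply max_le
      · have e : Real.log ‖N x‖ = (g x).re + Real.log ‖D x‖ := by
          rw [← h x, norm_mul, Real.log_mul (by simp) hpos.ne', Complex.norm_exp, Real.log_exp]
        have hNpos : 0 < ‖N x‖ := by
          rw [← h x, norm_mul]; exact mul_pos (norm_pos_iff.2 (Complex.exp_ne_zero _)) hpos
        have := Real.log_le_log hNpos hN
        linarith
      · have := Real.log_le_log hpos hDM
        linarith
  rw [circleAverage_fun_sub hconst hlog, circleAverage_const] at h2
  have := hc r hr
  change circleAverage f1 0 r ≤ _
  linarith

lemma wronskian_zero (u v : ℂ → ℂ) (hu : Differentiable ℂ u) (hv : Differentiable ℂ v)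
    (hv0 : ∃ z, v z ≠ 0) (hW : ∀ z, deriv u z * v z - u z * deriv v z = 0) :
    ∃ k : ℂ, ∀ z, u z = k * v z := by
  obtain ⟨z0, hz0⟩ := hv0
  have hev : ∀ᶠ z in 𝓝 z0, v z ≠ 0 := hv.continuous.continuousAt.eventually_ne hz0
  obtain ⟨ε, hε, hball⟩ := Metric.eventually_nhds_iff_ball.1 hev
  have hder : ∀ z ∈ ball z0 ε, HasDerivAt (fun x => u x / v x) 0 z := by
    intro z hz
    have := (hu z).hasDerivAt.div (hv z).hasDerivAt (hball z hz)
    rwa [hW z, zero_div] at this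
  refine ⟨u z0 / v z0, ?_⟩
  have hconst : ∀ z ∈ ball z0 ε, u z / v z = u z0 / v z0 := by
    intro z hz
    exact isOpen_ball.is_const_of_deriv_eq_zero (convex_ball z0 ε).isPreconnected
      (fun x hx => (hder x hx).differentiableAt.differentiableWithinAt)
      (fun x hx => (hder x hx).deriv) hz (mem_ball_self hε)
  have hA : AnalyticOnNhd ℂ u Set.univ := fun x _ => hu.analyticAt x
  have hB : AnalyticOnNhd ℂ (fun z => u z0 / v z0 * v z) Set.univ :=
    fun x _ => (hv.const_mul _).analyticAt x
  have := hA.eqOn_of_preconnected_of_eventuallyEq hB isPreconnected_univ (Set.mem_univ z0) (by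
    filter_upwards [ball_mem_nhds z0 hε] with z hz
    rw [← hconst z hz, div_mul_cancel₀ _ (hball z hz)])
  exact fun z => this (Set.mem_univ z)
lemma borel_identity (a b c : Polynomial ℂ) (hc : c ≠ 0) (g h : ℂ → ℂ)
    (hg : Differentiable ℂ g) (hh : Differentiable ℂ h)
    (hid : ∀ z, a.eval z * Complex.exp (g z) + b.eval z * Complex.exp (h z) = c.eval z) :
    (∃ k : ℂ, ∀ z, b.eval z * Complex.exp (h z) = k * c.eval z) ∨ (∀ z, g z = g 0) := by
  classical
  have hg' : Differentiable ℂ (deriv g) := fun z => (hg.analyticAt z).deriv.differentiableAt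
  have hh' : Differentiable ℂ (deriv h) := fun z => (hh.analyticAt z).deriv.differentiableAt
  have hdb : ∀ z, HasDerivAt (fun z => b.eval z * Complex.exp (h z))
      (b.derivative.eval z * Complex.exp (h z) +
        b.eval z * (Complex.exp (h z) * deriv h z)) z := fun z =>
    (b.hasDerivAt z).mul (hh z).hasDerivAt.cexp
  have hda : ∀ z, HasDerivAt (fun z => a.eval z * Complex.exp (g z))
      (a.derivative.eval z * Complex.exp (g z) +
        a.eval z * (Complex.exp (g z) * deriv g z)) z := fun z =>
    (a.hasDerivAt z).mul (hg z).hasDerivAt.cexp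
  have hid' : ∀ z, (a.derivative.eval z * Complex.exp (g z) +
        a.eval z * (Complex.exp (g z) * deriv g z)) + (b.derivative.eval z * Complex.exp (h z) +
        b.eval z * (Complex.exp (h z) * deriv h z)) = c.derivative.eval z := by
    intro z
    have h1 := (hda z).add (hdb z)
    have h2 : ((fun z => a.eval z * Complex.exp (g z)) + fun z => b.eval z * Complex.exp (h z))
      = fun z => c.eval z := by funext z; exact hid z
    rw [h2] at h1
    exact h1.unique (c.hasDerivAt z)
  let p1 := a * b.derivative - a.derivative * b
  let p2 := a * b
  let p3 := c * b.derivative - c.derivative * b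
  let p4 := c * b
  let p5 := c.derivative * a - c * a.derivative
  let p6 := -(c * a)
  let D : ℂ → ℂ := fun z => p1.eval z + p2.eval z * (deriv h z - deriv g z)
  let N1 : ℂ → ℂ := fun z => p3.eval z + p4.eval z * deriv h z
  let N2 : ℂ → ℂ := fun z => p5.eval z + p6.eval z * deriv g z
  have hN1 : ∀ z, Complex.exp (g z) * D z = N1 z := by
    intro z
    simp only [D, N1, p1, p2, p3, p4, Polynomial.eval_sub, Polynomial.eval_mul]
    linear_combination (b.derivative.eval z + b.eval z * deriv h z) * hid z - b.eval z * hid' z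
  have hN2 : ∀ z, Complex.exp (h z) * D z = N2 z := by
    intro z
    simp only [D, N2, p1, p2, p5, p6, Polynomial.eval_sub, Polynomial.eval_mul,
      Polynomial.eval_neg]
    linear_combination -(a.derivative.eval z + a.eval z * deriv g z) * hid z + a.eval z * hid' z
  have hDd : Differentiable ℂ D := by
    intro z
    have := hg' z
    have := hh' z
    have := p1.differentiableAt (x := z)
    have := p2.differentiableAt (x := z)
    fun_prop
  by_cases hD0 : ∃ z, D z ≠ 0
  swap
  · left
    push Not at hD0
    apply wronskian_zero (fun z => b.eval z * Complex.exp (h z)) (fun z => c.eval z)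
      (fun z => (hdb z).differentiableAt) (c.differentiable)
    · by_contra hcon
      push Not at hcon
      exact hc (Polynomial.funext (by simpa using hcon))
    · intro z
      have h1 := hN1 z
      rw [hD0 z, mul_zero] at h1
      rw [(hdb z).deriv, c.deriv]
      simp only [N1, p3, p4, Polynomial.eval_sub, Polynomial.eval_mul] at h1
      linear_combination -Complex.exp (h z) * h1
  right
  obtain ⟨C1, hC1⟩ := mean_bound g D N1 hg hDd hD0 hN1
  obtain ⟨C2, hC2⟩ := mean_bound h D N2 hh hDd hD0 hN2
  obtain ⟨A, hA, n, hpb⟩ := polybd {p1, p2, p3, p4, p5, p6}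
  have hgc := hg.continuous
  have hhc := hh.continuous
  let mg : ℝ → ℝ := fun r => circleAverage (fun x => max (g x).re 0) 0 r
  let mh : ℝ → ℝ := fun r => circleAverage (fun x => max (h x).re 0) 0 r
  have hmg0 : ∀ r, 0 ≤ mg r := fun r =>
    circleAverage_nonneg_of_nonneg (fun x _ => le_max_right _ _)
  have hmh0 : ∀ r, 0 ≤ mh r := fun r =>
    circleAverage_nonneg_of_nonneg (fun x _ => le_max_right _ _)
  let T : ℝ → ℝ := fun r => mg r + mh r
  have hT0 : ∀ r, 0 ≤ T r := fun r => add_nonneg (hmg0 r) (hmh0 r)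
  have hTc : Continuous T := by
    have h1 : Continuous mg := Continuous.circleAverage (by fun_prop)
    have h2 : Continuous mh := Continuous.circleAverage (by fun_prop)
    exact h1.add h2
  let G : ℝ := ‖g 0‖ + ‖h 0‖
  have hG : 0 ≤ G := by positivity
  have hdg : ∀ R z, ‖z‖ < R → ‖deriv g z‖ + ‖deriv h z‖ ≤
      2 * R / (R - ‖z‖) ^ 2 * (2 * T R + G) := by
    intro R z hz
    have h1 := deriv_bound g hg R z hz
    have h2 := deriv_bound h hh R z hz
    have : 2 * R / (R - ‖z‖) ^ 2 * (2 * T R + G) =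
      2 * R / (R - ‖z‖) ^ 2 * (2 * mg R + ‖g 0‖) + 2 * R / (R - ‖z‖) ^ 2 * (2 * mh R + ‖h 0‖) := by
      simp only [T, G]; ring
    rw [this]
    exact add_le_add h1 h2
  let B : ℝ := 5 + 2 * G
  let K : ℝ := 2 * (Real.log (A * B) + n + 4) + |C1| + |C2| + 1
  have hAB : 1 ≤ A * B := by
    have : 1 ≤ B := by simp only [B]; linarith
    nlinarith
  have hlAB := Real.log_nonneg hAB
  have hK : 1 ≤ K := by
    have : (0:ℝ) ≤ n := by positivity
    have := abs_nonneg C1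
    have := abs_nonneg C2
    simp only [K]; linarith
  obtain ⟨L, hL0, hL⟩ := growth T hTc hT0 K hK (by
    intro r R hr hrR
    have hR1 : 1 ≤ R := by linarith
    have hδ : 0 < R - r := by linarith
    let e : ℝ := 1 + 1 / (R - r)
    have he : 1 ≤ e := by
      have : 0 ≤ 1 / (R - r) := by positivity
      simp only [e]; linarith
    have hTR := hT0 R
    let M : ℝ := A * B * R ^ (n + 1) * (1 + T R) * e ^ 2
    have hM1 : 1 ≤ M := by
      have h1 : 1 ≤ R ^ (n+1) := one_le_pow₀ hR1
      have h2 : 1 ≤ e ^ 2 := one_le_pow₀ he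
      have h3 : 1 ≤ 1 + T R := by linarith
      exact one_le_mul_of_one_le_of_one_le (one_le_mul_of_one_le_of_one_le
        (one_le_mul_of_one_le_of_one_le hAB h1) h3) h2
    have hgen : ∀ z : ℂ, ‖z‖ = r → A * r ^ n * (1 + (‖deriv g z‖ + ‖deriv h z‖)) ≤ M := by
      intro z hz
      have h1 := hdg R z (by rw [hz]; exact hrR)
      rw [hz] at h1
      have h2 : 1 ≤ R * (1 + T R) * e ^ 2 :=
        one_le_mul_of_one_le_of_one_le (one_le_mul_of_one_le_of_one_le hR1 (by linarith))
          (one_le_pow₀ he)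
      have h3 : 2 * R / (R - r) ^ 2 * (2 * T R + G) ≤ (4 + 2 * G) * (R * (1 + T R) * e ^ 2) := by
        have : 2 * R / (R - r) ^ 2 * (2 * T R + G) =
          (R * (1 / (R - r)) ^ 2) * (4 * T R + 2 * G) := by field_simp; ring
        rw [this]
        have h4 : (1 / (R - r)) ^ 2 ≤ e ^ 2 := by
          gcongr; simp only [e]; linarith
        have h5 : 4 * T R + 2 * G ≤ (4 + 2 * G) * (1 + T R) := by nlinarith
        calc (R * (1 / (R - r)) ^ 2) * (4 * T R + 2 * G)
            ≤ (R * e ^ 2) * ((4 + 2 * G) * (1 + T R)) := by gcongr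
          _ = _ := by ring
      have h6 : r ^ n ≤ R ^ n := by gcongr
      calc A * r ^ n * (1 + (‖deriv g z‖ + ‖deriv h z‖))
          ≤ A * R ^ n * (B * (R * (1 + T R) * e ^ 2)) := by
            gcongr
            simp only [B]; linarith
        _ = M := by simp only [M]; ring
    have hpz : ∀ (p q : Polynomial ℂ) (x z : ℂ), p ∈ ({p1, p2, p3, p4, p5, p6} : Finset _) →
        q ∈ ({p1, p2, p3, p4, p5, p6} : Finset _) → ‖z‖ = r →
        ‖x‖ ≤ ‖deriv g z‖ + ‖deriv h z‖ → ‖p.eval z + q.eval z * x‖ ≤ M := by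
      intro p q x z hp hq hz hx
      have h1 := hpb p hp z (by rw [hz]; exact hr)
      have h2 := hpb q hq z (by rw [hz]; exact hr)
      rw [hz] at h1 h2
      refine le_trans ?_ (hgen z hz)
      calc ‖p.eval z + q.eval z * x‖ ≤ ‖p.eval z‖ + ‖q.eval z‖ * ‖x‖ := by
            rw [← norm_mul]; exact norm_add_le _ _
        _ ≤ A * r ^ n + A * r ^ n * (‖deriv g z‖ + ‖deriv h z‖) := by gcongr
        _ = _ := by ring
    have hDM : ∀ z, ‖z‖ = r → ‖D z‖ ≤ M := fun z hz =>
      hpz p1 p2 _ z (by simp) (by simp) hz (by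
        have := norm_sub_le (deriv h z) (deriv g z); linarith)
    have hN1M : ∀ z, ‖z‖ = r → ‖N1 z‖ ≤ M := fun z hz =>
      hpz p3 p4 _ z (by simp) (by simp) hz (by
        have := norm_nonneg (deriv g z); linarith)
    have hN2M : ∀ z, ‖z‖ = r → ‖N2 z‖ ≤ M := fun z hz =>
      hpz p5 p6 _ z (by simp) (by simp) hz (by
        have := norm_nonneg (deriv h z); linarith)
    have t1 : mg r ≤ _ := hC1 r hr M hM1 (fun z hz => ⟨hN1M z hz, hDM z hz⟩)
    have t2 : mh r ≤ _ := hC2 r hr M hM1 (fun z hz => ⟨hN2M z hz, hDM z hz⟩)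
    have hlogM : Real.log M = Real.log (A * B) + (n + 1) * Real.log R + Real.log (1 + T R)
        + 2 * Real.log e := by
      have q1 : A * B ≠ 0 := by positivity
      have q2 : R ^ (n+1) ≠ 0 := by positivity
      have q3 : 1 + T R ≠ 0 := by positivity
      have q4 : e ^ 2 ≠ 0 := by positivity
      simp only [M]
      rw [Real.log_mul (mul_ne_zero (mul_ne_zero q1 q2) q3) q4,
        Real.log_mul (mul_ne_zero q1 q2) q3, Real.log_mul q1 q2, Real.log_pow, Real.log_pow]
      push_cast; ring
    have l1 := Real.log_nonneg hR1
    have l2 : 0 ≤ Real.log (1 + T R) := Real.log_nonneg (by linarith)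
    have l3 : 0 ≤ Real.log e := Real.log_nonneg he
    change mg r + mh r ≤ K * (1 + Real.log R + Real.log (1 + T R) + Real.log e)
    have c1 := le_abs_self C1
    have c2 := le_abs_self C2
    have c3 := abs_nonneg C1
    have c4 := abs_nonneg C2
    have hn0 : (0:ℝ) ≤ n := by positivity
    have k1 : 2 * Real.log (A * B) + |C1| + |C2| ≤ K := by simp only [K]; linarith
    have k2 : 2 * ((n:ℝ) + 1) * Real.log R ≤ K * Real.log R := by
      gcongr; simp only [K]; linarith
    have k3 : 2 * Real.log (1 + T R) ≤ K * Real.log (1 + T R) := by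
      gcongr; simp only [K]; linarith
    have k4 : 4 * Real.log e ≤ K * Real.log e := by
      gcongr; simp only [K]; linarith
    rw [hlogM] at t1 t2
    linarith)
  have hder0 : ∀ z, deriv g z = 0 := by
    intro z
    have hlim : Tendsto (fun R : ℝ => 8 * ((2 * L + G) * R⁻¹ + 2 * L * (Real.log R / R)))
        atTop (𝓝 (8 * ((2 * L + G) * 0 + 2 * L * 0))) := by
      have h1 : Tendsto (fun R : ℝ => Real.log R / R) atTop (𝓝 0) := by
        simpa using Real.isLittleO_log_id_atTop.tendsto_div_nhds_zero
      exact ((tendsto_inv_atTop_zero.const_mul _).add (h1.const_mul _)).const_mul _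
    have hle : ‖deriv g z‖ ≤ 8 * ((2 * L + G) * 0 + 2 * L * 0) := by
      apply ge_of_tendsto hlim
      filter_upwards [eventually_ge_atTop (2 * ‖z‖ + 1)] with R hR
      have hz0 := norm_nonneg z
      have hR0 : 0 < R := by linarith
      have h1 := hdg R z (by linarith)
      have h2 := hL R (by linarith)
      have h3 : 0 ≤ Real.log R := Real.log_nonneg (by linarith)
      have h4 := norm_nonneg (deriv h z)
      have h5 : 2 * R / (R - ‖z‖) ^ 2 ≤ 8 * R⁻¹ := by
        have : (R / 2) ^ 2 ≤ (R - ‖z‖) ^ 2 := by gcongr; linarith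
        calc 2 * R / (R - ‖z‖) ^ 2 ≤ 2 * R / (R / 2) ^ 2 := by gcongr
          _ = 8 * R⁻¹ := by field_simp; ring
      have h6 : 2 * R / (R - ‖z‖) ^ 2 * (2 * T R + G) ≤
          8 * R⁻¹ * (2 * (L * (1 + Real.log R)) + G) := by
        have := hT0 R
        gcongr
      have h7 : 8 * R⁻¹ * (2 * (L * (1 + Real.log R)) + G) =
          8 * ((2 * L + G) * R⁻¹ + 2 * L * (Real.log R / R)) := by
        field_simp; ring
      linarith
    simpa using hle
  exact fun z => is_const_of_deriv_eq_zero hg hder0 z 0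


lemma exists_log (G : ℂ → ℂ) (hG : Differentiable ℂ G) (h0 : ∀ z, G z ≠ 0) :
    ∃ (k : ℂ) (φ : ℂ → ℂ), k ≠ 0 ∧ Differentiable ℂ φ ∧ ∀ z, G z = k * Complex.exp (φ z) := by
  have hd : Differentiable ℂ (deriv G) := by
    intro z
    exact (hG.analyticAt z).deriv.differentiableAt
  have hq : Differentiable ℂ (fun z => deriv G z / G z) := fun z => (hd z).div (hG z) (h0 z)
  obtain ⟨φ, hφ⟩ := hq.isExactOn_univ
  have hφ' : Differentiable ℂ φ := fun z => (hφ z (Set.mem_univ z)).differentiableAt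
  have hc : ∀ z, HasDerivAt (fun z => G z * Complex.exp (-φ z)) 0 z := by
    intro z
    have h1 : HasDerivAt (fun z => G z * Complex.exp (-φ z))
        (deriv G z * Complex.exp (-φ z) + G z * (Complex.exp (-φ z) * (-(deriv G z / G z)))) z :=
      ((hG z).hasDerivAt).mul (((hφ z (Set.mem_univ z)).neg).cexp)
    have h2 : deriv G z / G z * G z = deriv G z := div_mul_cancel₀ _ (h0 z)
    have h3 : deriv G z * Complex.exp (-φ z) + G z * (Complex.exp (-φ z) * (-(deriv G z / G z)))
        = 0 := by
      linear_combination (-Complex.exp (-φ z)) * h2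
    rwa [h3] at h1
  have hconst := is_const_of_deriv_eq_zero (f := fun z => G z * Complex.exp (-φ z))
    (fun z => (hc z).differentiableAt) (fun z => (hc z).deriv)
  refine ⟨G 0 * Complex.exp (-φ 0), φ, mul_ne_zero (h0 0) (Complex.exp_ne_zero _), hφ', ?_⟩
  intro z
  have := hconst z 0
  rw [← this, mul_assoc, ← Complex.exp_add]
  simp

lemma factor (f : ℂ → ℂ) (hf : MeromorphicOn f Set.univ)
    (htop : ∀ z, meromorphicOrderAt f z ≠ ⊤) (E : Set ℂ) (hE : E.Finite)
    (h0 : ∀ z, z ∉ E → meromorphicOrderAt f z = 0) :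
    ∃ (p q : Polynomial ℂ) (g : ℂ → ℂ), p ≠ 0 ∧ q ≠ 0 ∧ Differentiable ℂ g ∧
      ∀ z0, ∀ᶠ z in 𝓝[≠] z0, f z * p.eval z = q.eval z * Complex.exp (g z) := by
  have hsub : (MeromorphicOn.divisor f Set.univ).support ⊆ E := by
    intro z hz
    by_contra hzE
    apply hz
    rw [MeromorphicOn.divisor_apply hf (Set.mem_univ z), h0 z hzE]
    rfl
  have hfin : (MeromorphicOn.divisor f Set.univ).support.Finite := hE.subset hsub
  obtain ⟨G, hGan, hG0, hGe⟩ := MeromorphicOn.extract_zeros_poles hf (fun u => htop u) hfin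
  have hGd : Differentiable ℂ G := fun z => (hGan z (Set.mem_univ z)).differentiableAt
  obtain ⟨k, φ, hk, hφ, hGk⟩ := exists_log G hGd (fun z => hG0 ⟨z, Set.mem_univ z⟩)
  set d := MeromorphicOn.divisor f Set.univ with hd
  have hpoly : ∀ n : ℂ → ℕ, (∏ u ∈ hfin.toFinset, (Polynomial.X - Polynomial.C u) ^ n u) ≠ 0 := by
    intro n
    exact Finset.prod_ne_zero_iff.2 fun u _ => pow_ne_zero _ (Polynomial.X_sub_C_ne_zero u)
  refine ⟨∏ u ∈ hfin.toFinset, (Polynomial.X - Polynomial.C u) ^ (-(d u)).toNat,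
    Polynomial.C k * ∏ u ∈ hfin.toFinset, (Polynomial.X - Polynomial.C u) ^ (d u).toNat,
    φ, hpoly _, mul_ne_zero (Polynomial.C_ne_zero.2 hk) (hpoly _), hφ, ?_⟩
  intro z0
  have h1 := mem_codiscreteWithin_iff_forall_mem_nhdsNE.1 hGe z0 (Set.mem_univ z0)
  simp only [Set.compl_univ, Set.union_empty] at h1
  have h2 : ∀ᶠ z in 𝓝[≠] z0, z ∉ (hfin.toFinset : Set ℂ) := by
    have : IsClosed ((hfin.toFinset : Set ℂ) \ {z0}) :=
      (hfin.toFinset.finite_toSet.subset Set.sdiff_subset).isClosed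
    have h3 : ((hfin.toFinset : Set ℂ) \ {z0})ᶜ ∈ 𝓝 z0 := this.isOpen_compl.mem_nhds (by simp)
    filter_upwards [mem_nhdsWithin_of_mem_nhds h3, self_mem_nhdsWithin] with z hz hz'
    intro hzz
    exact hz ⟨hzz, hz'⟩
  filter_upwards [h1, h2] with z hz hz2
  have hz : f z = ((∏ᶠ u, (· - u) ^ d u) • G) z := hz
  rw [hz, Function.FactorizedRational.finprod_eq_fun (d := d) hfin]
  simp only [Pi.smul_apply', smul_eq_mul]
  rw [finprod_eq_prod_of_mulSupport_subset (s := hfin.toFinset)]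
  · rw [hGk z]
    simp only [Polynomial.eval_mul, Polynomial.eval_C, Polynomial.eval_prod, Polynomial.eval_pow, Polynomial.eval_sub, Polynomial.eval_X]
    have : (∏ u ∈ hfin.toFinset, (z - u) ^ d u) * (∏ u ∈ hfin.toFinset, (z - u) ^ (-(d u)).toNat)
        = ∏ u ∈ hfin.toFinset, (z - u) ^ (d u).toNat := by
      rw [← Finset.prod_mul_distrib]
      refine Finset.prod_congr rfl fun u hu => ?_
      have hne : z - u ≠ 0 := by
        intro h
        apply hz2
        rw [sub_eq_zero.1 h]
        exact hu
      rw [← zpow_natCast, ← zpow_natCast, ← zpow_add₀ hne]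
      congr 1
      omega
    rw [← this]; ring
  · intro u hu
    simp only [Function.mem_mulSupport] at hu
    simp only [Set.Finite.coe_toFinset, Function.mem_support]
    intro h
    apply hu
    have h' : d u = 0 := h
    rw [h', zpow_zero]

lemma bezout (P Q : Polynomial (Polynomial ℂ))
    (hcop : IsCoprime (P.map (algebraMap (Polynomial ℂ) (RatFunc ℂ)))
                      (Q.map (algebraMap (Polynomial ℂ) (RatFunc ℂ)))) :
    ∃ (U V : Polynomial (Polynomial ℂ)) (c : Polynomial ℂ), c ≠ 0 ∧
      U * P + V * Q = Polynomial.C c := by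
  obtain ⟨u, v, huv⟩ := hcop
  obtain ⟨b1, hb1, h1⟩ := IsLocalization.integerNormalization_spec (nonZeroDivisors (Polynomial ℂ)) u
  obtain ⟨b2, hb2, h2⟩ := IsLocalization.integerNormalization_spec (nonZeroDivisors (Polynomial ℂ)) v
  set U := IsLocalization.integerNormalization (nonZeroDivisors (Polynomial ℂ)) u
  set V := IsLocalization.integerNormalization (nonZeroDivisors (Polynomial ℂ)) v
  refine ⟨Polynomial.C b2 * U, Polynomial.C b1 * V, b1 * b2,
    mul_ne_zero (nonZeroDivisors.ne_zero hb1) (nonZeroDivisors.ne_zero hb2), ?_⟩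
  apply Polynomial.map_injective (algebraMap (Polynomial ℂ) (RatFunc ℂ))
    (IsFractionRing.injective (Polynomial ℂ) (RatFunc ℂ))
  simp only [Polynomial.map_add, Polynomial.map_mul, Polynomial.map_C, h1, h2]
  have e1 : ∀ (b : Polynomial ℂ) (x : Polynomial (RatFunc ℂ)), b • x = Polynomial.C (algebraMap (Polynomial ℂ) (RatFunc ℂ) b) * x := by
    intro b x
    rw [← Polynomial.smul_eq_C_mul]
    exact (algebraMap_smul (RatFunc ℂ) b x).symm
  rw [e1, e1, map_mul, map_mul]
  linear_combination (Polynomial.C (algebraMap (Polynomial ℂ) (RatFunc ℂ) b1) * Polynomial.C (algebraMap (Polynomial ℂ) (RatFunc ℂ) b2)) * huv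

lemma evZW_eq (P : Polynomial (Polynomial ℂ)) (z w : ℂ) :
    evZW P z w = ∑ i ∈ Finset.range (P.natDegree + 1), (P.coeff i).eval z * w ^ i := by
  unfold evZW
  rw [Polynomial.eval_map, Polynomial.eval₂_eq_sum_range]
  simp

lemma evZW_analytic (P : Polynomial (Polynomial ℂ)) (w : ℂ → ℂ) (z0 : ℂ) (hw : AnalyticAt ℂ w z0) :
    AnalyticAt ℂ (fun z => evZW P z (w z)) z0 := by
  simp only [evZW_eq]
  refine Finset.analyticAt_fun_sum _ fun i _ => ?_
  exact (AnalyticAt.aeval_polynomial (f := fun z => z) analyticAt_id (P.coeff i)).mul (hw.pow i)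

lemma evZW_sub (P : Polynomial (Polynomial ℂ)) : ∃ S : ℂ → ℂ → ℂ → ℂ,
    (∀ z w v, evZW P z w - evZW P z v = (w - v) * S z w v) ∧
    ∀ (w v : ℂ → ℂ) (z0 : ℂ), AnalyticAt ℂ w z0 → AnalyticAt ℂ v z0 →
      AnalyticAt ℂ (fun z => S z (w z) (v z)) z0 := by
  refine ⟨fun z w v => ∑ i ∈ Finset.range (P.natDegree + 1), (P.coeff i).eval z *
    ∑ j ∈ Finset.range i, w ^ j * v ^ (i - 1 - j), ?_, ?_⟩
  · intro z w v
    rw [evZW_eq, evZW_eq, ← Finset.sum_sub_distrib, Finset.mul_sum]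
    refine Finset.sum_congr rfl fun i _ => ?_
    have := (Commute.all w v).geom_sum₂_mul i
    linear_combination (-(P.coeff i).eval z) * this
  · intro w v z0 hw hv
    refine Finset.analyticAt_fun_sum _ fun i _ => ?_
    refine (AnalyticAt.aeval_polynomial (f := fun z => z) analyticAt_id (P.coeff i)).mul ?_
    refine Finset.analyticAt_fun_sum _ fun j _ => ?_
    exact (hw.pow _).mul (hv.pow _)

lemma local_unique (P Q : Polynomial (Polynomial ℂ)) (w v : ℂ → ℂ) (z0 : ℂ)
    (hw : AnalyticAt ℂ w z0) (hv : AnalyticAt ℂ v z0)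
    (ew : ∀ᶠ z in 𝓝 z0, deriv w z * evZW Q z (w z) = evZW P z (w z))
    (ev : ∀ᶠ z in 𝓝 z0, deriv v z * evZW Q z (v z) = evZW P z (v z))
    (hq : evZW Q z0 (w z0) ≠ 0) (h0 : w z0 = v z0) : ∀ᶠ z in 𝓝 z0, w z - v z = 0 := by
  obtain ⟨SP, hSP, aSP⟩ := evZW_sub P
  obtain ⟨SQ, hSQ, aSQ⟩ := evZW_sub Q
  have hu : AnalyticAt ℂ (fun z => w z - v z) z0 := hw.sub hv
  rw [← analyticOrderAt_eq_top]
  by_contra htop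
  have hpos : analyticOrderAt (fun z => w z - v z) z0 ≠ 0 := by
    rw [hu.analyticOrderAt_ne_zero]; simp [h0]
  obtain ⟨m, hm⟩ := ENat.ne_top_iff_exists.1 htop
  obtain ⟨n, rfl⟩ : ∃ n, m = n + 1 := by
    refine Nat.exists_eq_succ_of_ne_zero ?_
    rintro rfl
    exact hpos (by rw [← hm]; rfl)
  have hd := analyticOrderAt_deriv_of_pos hu (n := n) (by rw [← hm]; push_cast; rfl)
  have hQa := evZW_analytic Q w z0 hw
  have hSa : AnalyticAt ℂ (fun z => SP z (w z) (v z) - deriv v z * SQ z (w z) (v z)) z0 :=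
    (aSP w v z0 hw hv).sub (hv.deriv.mul (aSQ w v z0 hw hv))
  have heq : (deriv (fun z => w z - v z)) * (fun z => evZW Q z (w z)) =ᶠ[𝓝 z0]
      (fun z => w z - v z) * (fun z => SP z (w z) (v z) - deriv v z * SQ z (w z) (v z)) := by
    filter_upwards [ew, ev, hw.eventually_analyticAt, hv.eventually_analyticAt] with z h1 h2 h3 h4
    simp only [Pi.mul_apply]
    have hdz : deriv (fun z => w z - v z) z = deriv w z - deriv v z :=
      deriv_sub h3.differentiableAt h4.differentiableAt
    rw [hdz]
    linear_combination h1 - h2 + hSP z (w z) (v z) - deriv v z * hSQ z (w z) (v z)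
  have hord := analyticOrderAt_congr heq
  rw [analyticOrderAt_mul hu.deriv hQa, analyticOrderAt_mul hu hSa, hd, ← hm,
    (hQa.analyticOrderAt_eq_zero).2 hq, add_zero] at hord
  have : ((n + 1 : ℕ) : ℕ∞) ≤ (n : ℕ∞) := by
    rw [hord]; exact le_self_add
  have := Nat.cast_le.1 this
  omega

lemma poly_ev_ne (p : Polynomial ℂ) (hp : p ≠ 0) (z0 : ℂ) : ∀ᶠ z in 𝓝[≠] z0, p.eval z ≠ 0 := by
  have hfin : {z | p.eval z = 0}.Finite := by
    refine (p.roots.toFinset.finite_toSet).subset ?_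
    intro z hz
    simpa [hp] using hz
  have : IsClosed ({z | p.eval z = 0} \ {z0}) := (hfin.subset Set.sdiff_subset).isClosed
  have h3 : ({z | p.eval z = 0} \ {z0})ᶜ ∈ 𝓝 z0 := this.isOpen_compl.mem_nhds (by simp)
  filter_upwards [mem_nhdsWithin_of_mem_nhds h3, self_mem_nhdsWithin] with z hz hz'
  intro hzz
  exact hz ⟨hzz, hz'⟩

lemma rat_analytic (A B : Polynomial ℂ) (z0 : ℂ) (h : B.eval z0 ≠ 0) :
    AnalyticAt ℂ (fun z => A.eval z / B.eval z) z0 := by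
  have e : ∀ p : Polynomial ℂ, AnalyticAt ℂ (fun z => p.eval z) z0 := fun p =>
    AnalyticAt.aeval_polynomial (f := fun z => z) analyticAt_id p
  exact (e A).div (e B) h

lemma rat_mero (A B : Polynomial ℂ) (z0 : ℂ) :
    MeromorphicAt (fun z => A.eval z / B.eval z) z0 := by
  have e : ∀ p : Polynomial ℂ, AnalyticAt ℂ (fun z => p.eval z) z0 := fun p =>
    AnalyticAt.aeval_polynomial (f := fun z => z) analyticAt_id p
  exact (e A).meromorphicAt.div (e B).meromorphicAt

lemma order_diff (P Q U V : Polynomial (Polynomial ℂ)) (c : Polynomial ℂ)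
    (hUV : U * P + V * Q = Polynomial.C c)
    (w : ℂ → ℂ) (hw : MeromorphicOn w Set.univ)
    (hode : ∀ z : ℂ, AnalyticAt ℂ w z → deriv w z * evZW Q z (w z) = evZW P z (w z))
    (z0 : ℂ) (hc : c.eval z0 ≠ 0) :
    ∃ m : ℤ, ∀ A B : Polynomial ℂ, IsRatSolution P Q A B → B.eval z0 ≠ 0 →
      meromorphicOrderAt (fun z => w z - A.eval z / B.eval z) z0 ≠ ⊤ →
      meromorphicOrderAt (fun z => w z - A.eval z / B.eval z) z0 = m := by
  have hwm := hw z0 (Set.mem_univ z0)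
  by_cases hneg : meromorphicOrderAt w z0 < 0
  · obtain ⟨m, hm⟩ := WithTop.ne_top_iff_exists.1 (ne_top_of_lt hneg)
    refine ⟨m, fun A B hAB hB _ => ?_⟩
    rw [hm]
    have hr := (rat_analytic A B z0 hB).neg
    have h1 := meromorphicOrderAt_add_eq_left_of_lt (f₁ := w) hr.meromorphicAt
      (lt_of_lt_of_le hneg hr.meromorphicOrderAt_nonneg)
    rw [← h1]
    congr 1
  · push Not at hneg
    refine ⟨0, fun A B hAB hB htop => ?_⟩
    have hWa := (hwm.meromorphicOrderAt_nonneg_iff_analyticAt_toMeromorphicNFAt).1 hneg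
    have hWe := hwm.eq_nhdsNE_toMeromorphicNFAt
    set W := toMeromorphicNFAt w z0 with hW
    have hra := rat_analytic A B z0 hB
    have hcong : meromorphicOrderAt (fun z => w z - A.eval z / B.eval z) z0 =
        meromorphicOrderAt (fun z => W z - A.eval z / B.eval z) z0 := by
      apply meromorphicOrderAt_congr
      filter_upwards [hWe] with z hz
      rw [hz]
    rw [hcong] at htop ⊢
    have hWode' : ∀ᶠ z in 𝓝[≠] z0, deriv W z * evZW Q z (W z) = evZW P z (W z) := by
      have h1 : ∀ᶠ z in 𝓝[≠] z0, ∀ᶠ y in 𝓝 z, w y = W y :=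
        by
          have h2 := eventually_nhdsWithin_iff.1 hWe
          rw [eventually_nhdsWithin_iff]
          filter_upwards [eventually_eventually_nhds.2 h2] with z hz hzne
          filter_upwards [hz, isOpen_ne.mem_nhds hzne] with y hy hy2
          exact hy hy2
      have h3 : ∀ᶠ z in 𝓝[≠] z0, AnalyticAt ℂ w z := by
        have := hw.eventually_analyticAt (Set.mem_univ z0)
        rwa [← Set.compl_eq_univ_sdiff] at this
      filter_upwards [h1, h3] with z hz hza
      have := hode z hza
      have hz' : w =ᶠ[𝓝 z] W := hz
      rwa [hz'.deriv_eq, hz'.eq_of_nhds] at this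
    have hWode : ∀ᶠ z in 𝓝 z0, deriv W z * evZW Q z (W z) = evZW P z (W z) := by
      have a1 : ContinuousAt (fun z => deriv W z * evZW Q z (W z)) z0 :=
        (hWa.deriv.mul (evZW_analytic Q W z0 hWa)).continuousAt
      have a2 : ContinuousAt (fun z => evZW P z (W z)) z0 :=
        (evZW_analytic P W z0 hWa).continuousAt
      exact (a1.eventuallyEq_nhds_iff_eventuallyEq_nhdsNE a2).1 hWode'
    have hq : evZW Q z0 (W z0) ≠ 0 := by
      intro hq
      have hp := hWode.self_of_nhds
      rw [hq, mul_zero] at hp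
      apply hc
      have h := congrArg (fun R => evZW R z0 (W z0)) hUV
      simp only [evZW, Polynomial.map_add, Polynomial.map_mul, Polynomial.map_C,
        Polynomial.eval_add, Polynomial.eval_mul, Polynomial.eval_C] at h hp hq
      rw [← hp, hq] at h
      simpa using h.symm
    have hBn : ∀ᶠ z in 𝓝 z0, B.eval z ≠ 0 := by
      exact B.continuous.continuousAt.eventually_ne hB
    have hv : ∀ᶠ z in 𝓝 z0, deriv (fun x => A.eval x / B.eval x) z *
        evZW Q z ((fun x => A.eval x / B.eval x) z) = evZW P z ((fun x => A.eval x / B.eval x) z) := by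
      filter_upwards [hBn] with z hz
      exact hAB.2 z hz
    have hne : W z0 ≠ A.eval z0 / B.eval z0 := by
      intro h0
      have := local_unique P Q W (fun x => A.eval x / B.eval x) z0 hWa hra hWode hv hq h0
      apply htop
      rw [meromorphicOrderAt_eq_top_iff]
      exact this.filter_mono nhdsWithin_le_nhds
    have han : AnalyticAt ℂ (fun z => W z - A.eval z / B.eval z) z0 := hWa.sub hra
    rw [han.meromorphicOrderAt_eq, han.analyticOrderAt_eq_zero.2 (sub_ne_zero.2 hne)]
    rfl

lemma eq_of_ev (F G : ℂ → ℂ) (z0 : ℂ) (hF : ContinuousAt F z0) (hG : ContinuousAt G z0)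
    (h : ∀ᶠ z in 𝓝[≠] z0, F z = G z) : F z0 = G z0 :=
  Filter.EventuallyEq.eq_of_nhds ((hF.eventuallyEq_nhds_iff_eventuallyEq_nhdsNE hG).1 h)

lemma finish_ratio (A B A' B' T S : Polynomial ℂ) (hne : A * B' ≠ A' * B) (hT : T ≠ 0)
    (hB : B ≠ 0) (hB' : B' ≠ 0) (w : ℂ → ℂ)
    (hD : ∀ z0, ∀ᶠ z in 𝓝[≠] z0, w z - A'.eval z / B'.eval z ≠ 0)
    (h : ∀ z0, ∀ᶠ z in 𝓝[≠] z0,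
      (w z - A.eval z / B.eval z) / (w z - A'.eval z / B'.eval z) * T.eval z = S.eval z) :
    ∃ A₀ B₀ : Polynomial ℂ, B₀ ≠ 0 ∧ ∀ z0, ∀ᶠ z in 𝓝[≠] z0, w z * B₀.eval z = A₀.eval z := by
  have key : ∀ z0, ∀ᶠ z in 𝓝[≠] z0, w z * (B * B' * (T - S)).eval z =
      (A * B' * T - A' * B * S).eval z := by
    intro z0
    filter_upwards [hD z0, h z0, poly_ev_ne B hB z0, poly_ev_ne B' hB' z0] with z h1 h2 h3 h4
    rw [div_mul_eq_mul_div, div_eq_iff h1] at h2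
    simp only [Polynomial.eval_sub, Polynomial.eval_mul]
    field_simp at h2
    linear_combination h2
  refine ⟨_, _, ?_, key⟩
  refine mul_ne_zero (mul_ne_zero hB hB') ?_
  intro hTS
  have hTS' : T = S := sub_eq_zero.1 hTS
  apply hne
  have h0 : A * B' * T - A' * B * S = 0 := by
    by_contra hn
    obtain ⟨z, hz1, hz2⟩ := ((key 0).and (poly_ev_ne _ hn 0)).exists
    rw [hTS] at hz1
    apply hz2
    rw [← hz1]
    simp
  rw [← hTS', ← sub_mul] at h0
  exact sub_eq_zero.1 ((mul_eq_zero.1 h0).resolve_right hT)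

lemma golubev_ev
    (P Q : Polynomial (Polynomial ℂ))
    (hcop : IsCoprime (P.map (algebraMap (Polynomial ℂ) (RatFunc ℂ)))
                      (Q.map (algebraMap (Polynomial ℂ) (RatFunc ℂ))))
    (A₁ B₁ A₂ B₂ A₃ B₃ : Polynomial ℂ)
    (h₁ : IsRatSolution P Q A₁ B₁)
    (h₂ : IsRatSolution P Q A₂ B₂)
    (h₃ : IsRatSolution P Q A₃ B₃)
    (h₁₂ : A₁ * B₂ ≠ A₂ * B₁) (h₁₃ : A₁ * B₃ ≠ A₃ * B₁) (h₂₃ : A₂ * B₃ ≠ A₃ * B₂)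
    (w : ℂ → ℂ) (hw : MeromorphicOn w Set.univ)
    (hode : ∀ z : ℂ, AnalyticAt ℂ w z →
      deriv w z * evZW Q z (w z) = evZW P z (w z)) :
    ∃ A B : Polynomial ℂ, B ≠ 0 ∧ ∀ z0, ∀ᶠ z in 𝓝[≠] z0, w z * B.eval z = A.eval z := by
  obtain ⟨U, V, c, hc, hUV⟩ := bezout P Q hcop
  have hmero : ∀ A B : Polynomial ℂ,
      MeromorphicOn (fun z => w z - A.eval z / B.eval z) Set.univ := fun A B z _ =>
    (hw z (Set.mem_univ z)).sub (rat_mero A B z)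
  have hdich : ∀ A B : Polynomial ℂ, B ≠ 0 →
      (∃ A B : Polynomial ℂ, B ≠ 0 ∧ ∀ z0, ∀ᶠ z in 𝓝[≠] z0, w z * B.eval z = A.eval z) ∨
      (∀ z0, meromorphicOrderAt (fun z => w z - A.eval z / B.eval z) z0 ≠ ⊤) := by
    intro A B hB
    by_cases hall : ∀ z0, meromorphicOrderAt (fun z => w z - A.eval z / B.eval z) z0 ≠ ⊤
    · exact Or.inr hall
    · left
      refine ⟨A, B, hB, fun z0 => ?_⟩
      push Not at hall
      obtain ⟨z1, hz1⟩ := hall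
      have h0 : meromorphicOrderAt (fun z => w z - A.eval z / B.eval z) z0 = ⊤ := by
        by_contra hn
        exact (hmero A B).meromorphicOrderAt_ne_top_of_isPreconnected
          isPreconnected_univ (Set.mem_univ z0) (Set.mem_univ z1) hn hz1
      rw [meromorphicOrderAt_eq_top_iff] at h0
      filter_upwards [h0, poly_ev_ne B hB z0] with z e1 e2
      rw [sub_eq_zero.1 e1]
      exact div_mul_cancel₀ _ e2
  rcases hdich A₁ B₁ h₁.1 with h | t1
  · exact h
  rcases hdich A₂ B₂ h₂.1 with h | t2
  · exact h
  rcases hdich A₃ B₃ h₃.1 with h | t3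
  · exact h
  have hE : {z | (c * B₁ * B₂ * B₃).eval z = 0}.Finite := by
    have hne : c * B₁ * B₂ * B₃ ≠ 0 :=
      mul_ne_zero (mul_ne_zero (mul_ne_zero hc h₁.1) h₂.1) h₃.1
    refine ((c * B₁ * B₂ * B₃).roots.toFinset.finite_toSet).subset ?_
    intro z hz
    simp only [Finset.mem_coe, Multiset.mem_toFinset]
    exact (Polynomial.mem_roots hne).2 hz
  have hfac : ∀ A B A' B' : Polynomial ℂ, IsRatSolution P Q A B → IsRatSolution P Q A' B' →
      (∀ z, (c * B₁ * B₂ * B₃).eval z ≠ 0 → B.eval z ≠ 0 ∧ B'.eval z ≠ 0) →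
      (∀ z0, meromorphicOrderAt (fun z => w z - A.eval z / B.eval z) z0 ≠ ⊤) →
      (∀ z0, meromorphicOrderAt (fun z => w z - A'.eval z / B'.eval z) z0 ≠ ⊤) →
      ∃ (p q : Polynomial ℂ) (g : ℂ → ℂ), p ≠ 0 ∧ q ≠ 0 ∧ Differentiable ℂ g ∧
      ∀ z0, ∀ᶠ z in 𝓝[≠] z0, (w z - A.eval z / B.eval z) / (w z - A'.eval z / B'.eval z)
        * p.eval z = q.eval z * Complex.exp (g z) := by
    intro A B A' B' hAB hAB' hBB t t'
    have hord : ∀ z, meromorphicOrderAt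
        (fun z => (w z - A.eval z / B.eval z) / (w z - A'.eval z / B'.eval z)) z =
        meromorphicOrderAt (fun z => (w z - A.eval z / B.eval z)) z
          - meromorphicOrderAt (fun z => (w z - A'.eval z / B'.eval z)) z := fun z =>
      meromorphicOrderAt_div (hmero A B z (Set.mem_univ z)) (hmero A' B' z (Set.mem_univ z))
    refine factor _ (fun z hz => (hmero A B z hz).div (hmero A' B' z hz)) ?_ _ hE ?_
    · intro z
      rw [hord z]
      obtain ⟨m, hm⟩ := WithTop.ne_top_iff_exists.1 (t z)
      obtain ⟨n, hn⟩ := WithTop.ne_top_iff_exists.1 (t' z)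
      rw [← hm, ← hn, ← WithTop.LinearOrderedAddCommGroup.coe_sub]
      exact WithTop.coe_ne_top
    · intro z hz
      have hz : (c * B₁ * B₂ * B₃).eval z ≠ 0 := hz
      have hcz : c.eval z ≠ 0 := by
        intro h0
        apply hz
        simp [h0]
      obtain ⟨m, hm⟩ := order_diff P Q U V c hUV w hw hode z hcz
      rw [hord z, hm A B hAB (hBB z hz).1 (t z), hm A' B' hAB' (hBB z hz).2 (t' z),
        ← WithTop.LinearOrderedAddCommGroup.coe_sub, sub_self]
      rfl
  have hBz : ∀ z, (c * B₁ * B₂ * B₃).eval z ≠ 0 →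
      B₁.eval z ≠ 0 ∧ B₂.eval z ≠ 0 ∧ B₃.eval z ≠ 0 := by
    intro z hz
    refine ⟨?_, ?_, ?_⟩ <;> (intro h0; apply hz; simp [h0])
  obtain ⟨p1, q1, g, hp1, hq1, hg, e1⟩ := hfac A₁ B₁ A₂ B₂ h₁ h₂
    (fun z hz => ⟨(hBz z hz).1, (hBz z hz).2.1⟩) t1 t2
  obtain ⟨p3, q3, h, hp3, hq3, hh, e3⟩ := hfac A₃ B₃ A₂ B₂ h₃ h₂
    (fun z hz => ⟨(hBz z hz).2.2, (hBz z hz).2.1⟩) t3 t2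
  have hD2 : ∀ z0, ∀ᶠ z in 𝓝[≠] z0, w z - A₂.eval z / B₂.eval z ≠ 0 := fun z0 =>
    (meromorphicOrderAt_ne_top_iff_eventually_ne_zero (hmero A₂ B₂ z0 (Set.mem_univ z0))).1 (t2 z0)
  have hcc : p1 * p3 * (B₂ * (A₁ * B₃ - A₃ * B₁)) ≠ 0 :=
    mul_ne_zero (mul_ne_zero hp1 hp3) (mul_ne_zero h₂.1 (sub_ne_zero.2 h₁₃))
  have hbb : q3 * p1 * (A₁ * B₂ - A₂ * B₁) * B₃ ≠ 0 :=
    mul_ne_zero (mul_ne_zero (mul_ne_zero hq3 hp1) (sub_ne_zero.2 h₁₂)) h₃.1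
  have hid : ∀ z, (-(q1 * p3 * (A₃ * B₂ - A₂ * B₃) * B₁)).eval z * Complex.exp (g z) +
      (q3 * p1 * (A₁ * B₂ - A₂ * B₁) * B₃).eval z * Complex.exp (h z) =
      (p1 * p3 * (B₂ * (A₁ * B₃ - A₃ * B₁))).eval z := by
    intro z0
    refine eq_of_ev (fun z => (-(q1 * p3 * (A₃ * B₂ - A₂ * B₃) * B₁)).eval z * Complex.exp (g z) +
      (q3 * p1 * (A₁ * B₂ - A₂ * B₁) * B₃).eval z * Complex.exp (h z))
      (fun z => (p1 * p3 * (B₂ * (A₁ * B₃ - A₃ * B₁))).eval z) z0 ?_ ?_ ?_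
    · have := hg.continuous
      have := hh.continuous
      fun_prop
    · fun_prop
    · filter_upwards [e1 z0, e3 z0, hD2 z0, poly_ev_ne _ h₁.1 z0, poly_ev_ne _ h₂.1 z0,
        poly_ev_ne _ h₃.1 z0] with z k1 k3 kD b1 b2 b3
      simp only [Polynomial.eval_neg, Polynomial.eval_mul, Polynomial.eval_sub]
      set D := w z - A₂.eval z / B₂.eval z with hD
      have r1 : (w z - A₁.eval z / B₁.eval z) / D * D = w z - A₁.eval z / B₁.eval z :=
        div_mul_cancel₀ _ kD
      have r3 : (w z - A₃.eval z / B₃.eval z) / D * D = w z - A₃.eval z / B₃.eval z :=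
        div_mul_cancel₀ _ kD
      set f1 := (w z - A₁.eval z / B₁.eval z) / D
      set f3 := (w z - A₃.eval z / B₃.eval z) / D
      have s1 : (1 - f1) * D * (B₁.eval z * B₂.eval z) =
          A₁.eval z * B₂.eval z - A₂.eval z * B₁.eval z := by
        rw [sub_mul, r1, hD]; field_simp; ring
      have s3 : (1 - f3) * D * (B₃.eval z * B₂.eval z) =
          A₃.eval z * B₂.eval z - A₂.eval z * B₃.eval z := by
        rw [sub_mul, r3, hD]; field_simp; ring
      rw [← s1, ← s3]
      have s13 : B₂.eval z * (A₁.eval z * B₃.eval z - A₃.eval z * B₁.eval z) =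
        (1 - f1) * D * (B₁.eval z * B₂.eval z) * B₃.eval z
          - (1 - f3) * D * (B₃.eval z * B₂.eval z) * B₁.eval z := by
        rw [s1, s3]; ring
      rw [s13]
      linear_combination (p3.eval z * ((1 - f3) * D * (B₃.eval z * B₂.eval z)) * B₁.eval z) * k1
        - (p1.eval z * ((1 - f1) * D * (B₁.eval z * B₂.eval z)) * B₃.eval z) * k3
  rcases borel_identity _ _ _ hcc g h hg hh hid with ⟨k, hk⟩ | hk
  · refine finish_ratio A₃ B₃ A₂ B₂ (p3 * (q3 * p1 * (A₁ * B₂ - A₂ * B₁) * B₃))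
      (q3 * (Polynomial.C k * (p1 * p3 * (B₂ * (A₁ * B₃ - A₃ * B₁))))) h₂₃.symm
      (mul_ne_zero hp3 hbb) h₃.1 h₂.1 w hD2 ?_
    intro z0
    filter_upwards [e3 z0] with z k3
    have hkz := hk z
    simp only [Polynomial.eval_mul, Polynomial.eval_C] at hkz ⊢
    rw [← hkz, ← mul_assoc, k3]
    ring
  · refine finish_ratio A₁ B₁ A₂ B₂ p1 (q1 * Polynomial.C (Complex.exp (g 0))) h₁₂
      hp1 h₁.1 h₂.1 w hD2 ?_
    intro z0
    filter_upwards [e1 z0] with z k1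
    rw [k1, hk z]
    simp

end golubevHelpers

/-- **Golubev's theorem (1911).**  Let `P, Q ∈ ℂ[z][w]`, `Q ≠ 0`, with `P, Q` coprime
as polynomials in `w` over `ℂ(z)`.  If the equation `w' · Q(z, w) = P(z, w)` has three
pairwise distinct rational solutions `A₁/B₁`, `A₂/B₂`, `A₃/B₃`, then every
single-valued solution of the ODE — every function meromorphic on all of `ℂ` satisfying
the equation at each point of analyticity — is a rational function. -/
theorem golubev
    (P Q : Polynomial (Polynomial ℂ)) (hQ : Q ≠ 0)
    (hcop : IsCoprime (P.map (algebraMap (Polynomial ℂ) (RatFunc ℂ)))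
                      (Q.map (algebraMap (Polynomial ℂ) (RatFunc ℂ))))
    (A₁ B₁ A₂ B₂ A₃ B₃ : Polynomial ℂ)
    (h₁ : IsRatSolution P Q A₁ B₁)
    (h₂ : IsRatSolution P Q A₂ B₂)
    (h₃ : IsRatSolution P Q A₃ B₃)
    (h₁₂ : A₁ * B₂ ≠ A₂ * B₁) (h₁₃ : A₁ * B₃ ≠ A₃ * B₁) (h₂₃ : A₂ * B₃ ≠ A₃ * B₂)
    (w : ℂ → ℂ) (hw : MeromorphicOn w Set.univ)
    (hode : ∀ z : ℂ, AnalyticAt ℂ w z →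
      deriv w z * evZW Q z (w z) = evZW P z (w z)) :
    ∃ A B : Polynomial ℂ, B ≠ 0 ∧
      ∀ z : ℂ, AnalyticAt ℂ w z → w z * B.eval z = A.eval z := by
  obtain ⟨A, B, hB, h⟩ := golubev_ev P Q hcop A₁ B₁ A₂ B₂ A₃ B₃ h₁ h₂ h₃ h₁₂ h₁₃ h₂₃ w hw hode
  refine ⟨A, B, hB, fun z hz => ?_⟩
  refine eq_of_ev (fun z => w z * B.eval z) (fun z => A.eval z) z ?_ ?_ (h z)
  · exact hz.continuousAt.mul B.continuous.continuousAt
  · exact A.continuous.continuousAt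
end

section
/- Yosida's theorem: let m ≥ 1 be an integer and let R(x,y) = Σ_{k=0}^{d} r_k(x)·y^k with rational function coefficients r_k ∈ ℂ(x) and r_d ≠ 0, so that deg_y R = d. If the ODE (y′)^m = R(x,y) has a transcendental meromorphic solution — a function y meromorphic on all of ℂ which is not a rational function and satisfies (y′(x))^m = R(x, y(x)) for every x at which y is analytic and all r_k are finite — then d ≤ 2m. -/
open Filter Topology Bornology

lemma polyUpper (p : Polynomial ℂ) : ∀ K : ℕ, p.natDegree < K → 
    ∀ᶠ x in cobounded ℂ, ‖p.eval x‖ ≤ ‖x‖ ^ K := by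
  intro K hK
  have h : p.degree < (Polynomial.X ^ K : Polynomial ℂ).degree := by
    rw [Polynomial.degree_X_pow]
    exact lt_of_le_of_lt Polynomial.degree_le_natDegree (by exact_mod_cast hK)
  have := Polynomial.isLittleO_cobounded_of_degree_lt h
  filter_upwards [this.bound (c := 1) one_pos] with x hx
  simpa using hx

lemma polyLower (p : Polynomial ℂ) (hp : p ≠ 0) : ∃ c > 0, 
    ∀ᶠ x in cobounded ℂ, c ≤ ‖p.eval x‖ := by
  have h : (1 : Polynomial ℂ).degree ≤ p.degree := by
    rw [Polynomial.degree_one]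
    exact Polynomial.zero_le_degree_iff.2 hp
  have := Polynomial.isBigO_cobounded_of_degree_le h
  obtain ⟨c, hc, h⟩ := this.exists_pos
  refine ⟨c⁻¹, inv_pos.2 hc, ?_⟩
  filter_upwards [h.bound] with x hx
  rw [inv_le_iff_one_le_mul₀' hc]
  simpa using hx

lemma lemA (m d : ℕ) (hd : 1 ≤ d) (p : ℕ → Polynomial ℂ) (D : Polynomial ℂ) (hp : p d ≠ 0) :
    ∃ K : ℕ, ∃ c > (0:ℝ), ∀ᶠ x in cobounded ℂ, ∀ y w : ℂ, ‖x‖ ^ (K+1) ≤ ‖y‖ →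
      D.eval x * w ^ m = ∑ k ∈ Finset.range (d+1), (p k).eval x * y ^ k →
      c * ‖y‖ ^ d ≤ ‖x‖ ^ K * ‖w‖ ^ m := by
  obtain ⟨c, hc, hlow⟩ := polyLower (p d) hp
  let K := D.natDegree + ∑ k ∈ Finset.range d, (p k).natDegree + 1
  have hK : ∀ k ∈ Finset.range d, (p k).natDegree < K := by
    intro k hk
    have := Finset.single_le_sum (f := fun k => (p k).natDegree) (fun _ _ => Nat.zero_le _) hk
    simp only [K] at *
    omega
  have hDK : D.natDegree < K := by simp only [K]; omega
  refine ⟨K, c/2, half_pos hc, ?_⟩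
  have h1 : ∀ᶠ x in cobounded ℂ, ∀ k ∈ Finset.range d, ‖(p k).eval x‖ ≤ ‖x‖ ^ K := by
    rw [Finset.eventually_all]
    intro k hk
    exact polyUpper _ _ (hK k hk)
  have h2 : ∀ᶠ x in cobounded ℂ, max 1 (2 * d / c) ≤ ‖x‖ :=
    tendsto_norm_cobounded_atTop.eventually_ge_atTop _
  filter_upwards [hlow, h1, h2, polyUpper D K hDK] with x hl hu hx hD y w hy he
  have hx1 : 1 ≤ ‖x‖ := le_trans (le_max_left _ _) hx
  have hx2 : 2 * d ≤ c * ‖x‖ := by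
    have := le_trans (le_max_right _ _) hx
    rwa [div_le_iff₀' hc] at this
  have hy1 : 1 ≤ ‖y‖ := le_trans (one_le_pow₀ hx1) hy
  rw [Finset.sum_range_succ] at he
  have hs : ‖∑ k ∈ Finset.range d, (p k).eval x * y ^ k‖ ≤ d * (‖x‖ ^ K * ‖y‖ ^ (d-1)) := by
    suffices hb : ∀ k ∈ Finset.range d, ‖(p k).eval x * y ^ k‖ ≤ ‖x‖ ^ K * ‖y‖ ^ (d-1) by
      exact (norm_sum_le_of_le _ hb).trans (by simp)
    intro k hk
    rw [norm_mul, norm_pow]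
    have := hu k hk
    have hk' := Finset.mem_range.1 hk
    gcongr
    omega
  have h3 : c * ‖y‖ ^ d ≤ ‖(p d).eval x * y ^ d‖ := by
    rw [norm_mul, norm_pow]; gcongr
  have h4 : ‖D.eval x * w ^ m‖ ≤ ‖x‖ ^ K * ‖w‖ ^ m := by
    rw [norm_mul, norm_pow]; gcongr
  have h5 : d * (‖x‖ ^ K * ‖y‖ ^ (d-1)) ≤ c / 2 * ‖y‖ ^ d := by
    have : ‖y‖ ^ d = ‖y‖ ^ (d-1) * ‖y‖ := by rw [← pow_succ]; congr 1; omega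
    rw [this]
    have h6 : (d:ℝ) * ‖x‖ ^ K ≤ c / 2 * ‖y‖ := by
      calc (d:ℝ) * ‖x‖ ^ K ≤ (c * ‖x‖ / 2) * ‖x‖ ^ K := by gcongr; linarith
        _ = c / 2 * ‖x‖ ^ (K+1) := by ring
        _ ≤ _ := by gcongr
    calc _ = ((d:ℝ) * ‖x‖ ^ K) * ‖y‖ ^ (d-1) := by ring
      _ ≤ (c / 2 * ‖y‖) * ‖y‖ ^ (d-1) := by gcongr
      _ = _ := by ring
  have h7 : ‖(p d).eval x * y ^ d‖ ≤ ‖D.eval x * w ^ m‖ + ‖∑ k ∈ Finset.range d, (p k).eval x * y ^ k‖ := by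
    have : (p d).eval x * y ^ d = D.eval x * w ^ m - ∑ k ∈ Finset.range d, (p k).eval x * y ^ k := by
      rw [he]; ring
    rw [this]; exact norm_sub_le _ _
  linarith

lemma step (f : ℂ → ℂ) (x : ℂ) (h0 : 0 < ‖f x‖) (hf : ∀ z ∈ Metric.closedBall x (2 / ‖f x‖), AnalyticAt ℂ f z)
    (h : ‖f x‖ ^ 2 ≤ ‖deriv f x‖) : ∃ z ∈ Metric.closedBall x (2 / ‖f x‖), 2 * ‖f x‖ ≤ ‖f z‖ := by
  by_contra! hc
  have hr : 0 < 2 / ‖f x‖ := by positivity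
  obtain ⟨z, hz, hmax⟩ := (isCompact_sphere x (2 / ‖f x‖)).exists_isMaxOn 
    (by simpa using hr.le) (f := fun z => ‖f z‖) (fun z hz => (hf z (Metric.sphere_subset_closedBall hz)).continuousAt.norm.continuousWithinAt)
  have h2 := Complex.norm_deriv_le_of_forall_mem_sphere_norm_le (f := f) (c := x) hr 
    (C := ‖f z‖) ((DifferentiableOn.diffContOnCl (fun w hw => by
      rw [closure_ball _ hr.ne'] at hw
      exact (hf w hw).differentiableAt.differentiableWithinAt))) (fun w hw => hmax hw)
  have h3 := hc z (Metric.sphere_subset_closedBall hz)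
  have : ‖f z‖ / (2 / ‖f x‖) < ‖f x‖ ^ 2 := by
    rw [div_lt_iff₀ hr]
    calc _ < _ := h3
      _ = _ := by field_simp
  linarith

lemma lemB (f : ℂ → ℂ) (R : ℝ) (N : ℕ) (hR : 1 ≤ R) (hf : ∀ z, R ≤ ‖z‖ → AnalyticAt ℂ f z)
    (h : ∀ z, R ≤ ‖z‖ → ‖z‖ ^ N ≤ ‖f z‖ → ‖f z‖ ^ 2 ≤ ‖deriv f z‖) (x : ℂ) (hx : R + 1 ≤ ‖x‖) :
    ‖f x‖ ≤ 4 * (‖x‖ + 1) ^ N := by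
  by_contra! hc
  set A := ‖f x‖ with hA
  have h1N : 1 ≤ (‖x‖ + 1) ^ N := one_le_pow₀ (by linarith [norm_nonneg x])
  have hA4 : 4 < A := by linarith
  have key : ∀ n : ℕ, ∀ z : ℂ, dist z x ≤ 4 / A * (1 - 1 / 2 ^ n) → 2 ^ n * A ≤ ‖f z‖ →
      ∃ z' : ℂ, dist z' x ≤ 4 / A * (1 - 1 / 2 ^ (n+1)) ∧ 2 ^ (n+1) * A ≤ ‖f z'‖ ∧ dist z z' ≤ 2 / A / 2 ^ n := by
    intro n z hz hfz
    have hA1 : 4 / A ≤ 1 := by rw [div_le_one (by linarith)]; linarith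
    have hp : (1:ℝ) ≤ 2 ^ n := one_le_pow₀ (by norm_num)
    have hfz' : A ≤ ‖f z‖ := by nlinarith
    have hr : 2 / ‖f z‖ ≤ 2 / A / 2 ^ n := by
      rw [div_div]
      apply div_le_div_of_nonneg_left (by norm_num) (by positivity)
      linarith
    have hsum : 4 / A * (1 - 1 / 2 ^ n) + 2 / A / 2 ^ n = 4 / A * (1 - 1 / 2 ^ (n+1)) := by
      rw [pow_succ]; field_simp; ring
    have hle : ∀ k : ℕ, 4 / A * (1 - 1 / 2 ^ k) ≤ 1 := by
      intro k
      have : (0:ℝ) ≤ 1 / 2 ^ k := by positivity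
      have h4 : 0 < 4 / A := by positivity
      nlinarith
    have hd1 : dist z x ≤ 1 := hz.trans (hle n)
    have hnorm : ∀ w : ℂ, dist w x ≤ 1 → R ≤ ‖w‖ ∧ ‖w‖ ≤ ‖x‖ + 1 := by
      intro w hw
      rw [dist_eq_norm] at hw
      have h1 := norm_sub_norm_le x w
      have h2 := norm_sub_norm_le w x
      rw [norm_sub_rev] at h1
      constructor <;> linarith
    have hzb := hnorm z hd1
    have hball : ∀ w ∈ Metric.closedBall z (2 / ‖f z‖), dist w x ≤ 4 / A * (1 - 1 / 2 ^ (n+1)) := by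
      intro w hw
      rw [← hsum]
      have := dist_triangle w z x
      rw [Metric.mem_closedBall] at hw
      linarith
    obtain ⟨z', hz', hz''⟩ := step f z (by linarith) (fun w hw => hf w (hnorm w ((hball w hw).trans (hle _))).1)
      (h z hzb.1 (by
        have : ‖z‖ ^ N ≤ (‖x‖ + 1) ^ N := by gcongr; exact hzb.2
        linarith))
    refine ⟨z', hball z' hz', ?_, ?_⟩
    · rw [pow_succ]; linarith
    · rw [dist_comm]; exact (Metric.mem_closedBall.1 hz').trans hr
  let S : ℕ → Type := fun n => {z : ℂ // dist z x ≤ 4 / A * (1 - 1 / 2 ^ n) ∧ 2 ^ n * A ≤ ‖f z‖}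
  let g : (n : ℕ) → S n := fun n => Nat.rec ⟨x, by simp, by simp [hA]⟩
    (fun n z => ⟨(key n z.1 z.2.1 z.2.2).choose, (key n z.1 z.2.1 z.2.2).choose_spec.1,
      (key n z.1 z.2.1 z.2.2).choose_spec.2.1⟩) n
  let u : ℕ → ℂ := fun n => (g n).1
  have hu : ∀ n, dist (u n) (u (n+1)) ≤ 2 / A / 2 ^ n := fun n =>
    (key n (g n).1 (g n).2.1 (g n).2.2).choose_spec.2.2
  have hcs : CauchySeq u := cauchySeq_of_le_geometric (1/2) (2/A) (by norm_num) (by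
    intro n
    refine (hu n).trans (le_of_eq ?_)
    rw [one_div, inv_pow]; rfl)
  obtain ⟨a, ha⟩ := cauchySeq_tendsto_of_complete hcs
  have hax : dist a x ≤ 1 := by
    refine le_of_tendsto (ha.dist tendsto_const_nhds) (Eventually.of_forall fun n => ?_)
    refine (g n).2.1.trans ?_
    have hA1 : 4 / A ≤ 1 := by rw [div_le_one (by linarith)]; linarith
    have : (0:ℝ) ≤ 1 / 2 ^ n := by positivity
    have h4 : 0 < 4 / A := by positivity
    nlinarith
  have haR : R ≤ ‖a‖ := by
    rw [dist_eq_norm, norm_sub_rev] at hax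
    have h1 := norm_sub_norm_le x a
    linarith
  have hlim := ((hf a haR).continuousAt.tendsto.comp ha).norm
  refine not_tendsto_nhds_of_tendsto_atTop ?_ _ hlim
  refine tendsto_atTop_mono (fun n => (g n).2.2) ?_
  exact (tendsto_pow_atTop_atTop_of_one_lt (by norm_num)).atTop_mul_const (by linarith)

lemma lemC (f : ℂ → ℂ) (hf : Differentiable ℂ f) (N : ℕ) (h : ∀ᶠ x in cobounded ℂ, ‖f x‖ ≤ ‖x‖ ^ N) :
    ∃ A : Polynomial ℂ, ∀ x, f x = A.eval x := by
  have hz : ∀ n, N < n → iteratedDeriv n f 0 = 0 := by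
    intro n hn
    have hb : ∀ᶠ R : ℝ in atTop, ‖iteratedDeriv n f 0‖ ≤ n.factorial * R⁻¹ := by
      rw [← comap_norm_atTop, eventually_comap] at h
      filter_upwards [h, eventually_ge_atTop 1] with R hR h1
      have h0 : 0 < R := by linarith
      refine (Complex.norm_iteratedDeriv_le_of_forall_mem_sphere_norm_le n h0 hf.diffContOnCl
        (C := R ^ N) ?_).trans ?_
      · intro z hz
        have hz' : ‖z‖ = R := by simpa using hz
        have := hR z hz'
        rwa [hz'] at this
      · rw [mul_div_assoc]
        gcongr
        rw [div_le_iff₀ (by positivity), inv_mul_eq_div, le_div_iff₀ h0, ← pow_succ]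
        exact pow_le_pow_right₀ h1 hn
    have hl : Tendsto (fun R : ℝ => (n.factorial : ℝ) * R⁻¹) atTop (𝓝 ((n.factorial : ℝ) * 0)) :=
      tendsto_inv_atTop_zero.const_mul _
    rw [mul_zero] at hl
    exact norm_le_zero_iff.1 (ge_of_tendsto hl hb)
  refine ⟨∑ n ∈ Finset.range (N+1), Polynomial.C ((n.factorial : ℂ)⁻¹ * iteratedDeriv n f 0) * Polynomial.X ^ n, fun x => ?_⟩
  have hs := Complex.hasSum_taylorSeries_of_entire hf 0 x
  have hs' := hasSum_sum_of_ne_finset_zero (s := Finset.range (N+1)) (L := .unconditional ℕ)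
    (f := fun n => (n.factorial : ℂ)⁻¹ • (x - 0) ^ n • iteratedDeriv n f 0) (by
    intro n hn
    simp only [Finset.mem_range, not_lt] at hn
    simp [hz n (by omega)])
  rw [hs.unique hs', Polynomial.eval_finsetSum]
  refine Finset.sum_congr rfl fun n _ => ?_
  simp
  ring

lemma lemE (Y : ℂ → ℂ) (x : ℂ) (K m d : ℕ) (c : ℝ) (hc : 0 < c) (hd : 2 * m < d)
    (hY : MeromorphicAt Y x) (h : ∀ᶠ z in 𝓝[≠] x, ‖z‖ ^ (K+1) ≤ ‖Y z‖ →
      c * ‖Y z‖ ^ d ≤ ‖z‖ ^ K * ‖deriv Y z‖ ^ m) : 0 ≤ meromorphicOrderAt Y x := by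
  by_contra! hneg
  have hinf := tendsto_norm_cobounded_atTop.comp (tendsto_cobounded_of_meromorphicOrderAt_neg hneg)
  let w := toMeromorphicNFAt Y⁻¹ x
  have hw : AnalyticAt ℂ w x := by
    rw [← hY.inv.meromorphicOrderAt_nonneg_iff_analyticAt_toMeromorphicNFAt, meromorphicOrderAt_inv]
    generalize meromorphicOrderAt Y x = o at hneg
    induction o with
    | top => simp at hneg
    | coe o => 
      have : o < 0 := by exact_mod_cast hneg
      have h2 : (0:ℤ) ≤ -o := by omega
      exact_mod_cast h2
  have hwY : ∀ᶠ z in 𝓝[≠] x, ∀ᶠ t in 𝓝 z, Y⁻¹ t = w t := 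
    eventually_nhdsNE_eventually_nhds_iff.2 hY.inv.eq_nhdsNE_toMeromorphicNFAt
  have hle : ∀ᶠ z in 𝓝[≠] x, c * ‖Y z‖ ≤ ‖z‖ ^ K * ‖deriv w z‖ ^ m := by
    have hcont : Tendsto (fun z : ℂ => ‖z‖ ^ (K+1)) (𝓝[≠] x) (𝓝 (‖x‖ ^ (K+1))) :=
      ((continuous_norm.pow _).tendsto x).mono_left nhdsWithin_le_nhds
    filter_upwards [h, hwY, hY.eventually_analyticAt, hinf.eventually_ge_atTop 1,
      hinf.eventually_ge_atTop (‖x‖ ^ (K+1) + 1), hcont.eventually_lt_const (lt_add_one _)] with z hz hwz ha h1 h2 h3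
    simp only [Function.comp] at h1 h2
    have h4 := hz (by linarith)
    have h0 : Y z ≠ 0 := by
      rw [← norm_pos_iff]; linarith
    have hder : deriv w z = - deriv Y z / Y z ^ 2 := by
      rw [← Filter.EventuallyEq.deriv_eq (f₁ := Y⁻¹) hwz]
      exact (ha.differentiableAt.hasDerivAt.inv h0).deriv
    rw [hder, norm_div, norm_neg, div_pow, ← mul_div_assoc, norm_pow, ← pow_mul,
      le_div_iff₀ (by positivity), mul_assoc, ← pow_succ']
    refine le_trans ?_ h4
    gcongr
    omega
  have hl : Tendsto (fun z => ‖z‖ ^ K * ‖deriv w z‖ ^ m) (𝓝[≠] x) (𝓝 (‖x‖ ^ K * ‖deriv w x‖ ^ m)) := by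
    have h1 : ContinuousAt (deriv w) x := hw.deriv.continuousAt
    have : ContinuousAt (fun z => ‖z‖ ^ K * ‖deriv w z‖ ^ m) x := by fun_prop
    exact this.tendsto.mono_left nhdsWithin_le_nhds
  exact not_tendsto_nhds_of_tendsto_atTop
    (tendsto_atTop_mono' _ hle (hinf.const_mul_atTop hc)) _ hl

lemma clearDen (m d : ℕ) (r : ℕ → RatFunc ℂ) (hrd : r d ≠ 0) :
    ∃ (p : ℕ → Polynomial ℂ) (D : Polynomial ℂ), p d ≠ 0 ∧ D ≠ 0 ∧
      ∀ x y w : ℂ, D.eval x ≠ 0 → 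
        ((∀ k, k ≤ d → (r k).denom.eval x ≠ 0) → w ^ m =
        ∑ k ∈ Finset.range (d + 1), RatFunc.eval (RingHom.id ℂ) x (r k) * y ^ k) →
      D.eval x * w ^ m = ∑ k ∈ Finset.range (d+1), (p k).eval x * y ^ k := by
  refine ⟨fun k => (r k).num * ∏ j ∈ (Finset.range (d+1)).erase k, (r j).denom,
    ∏ j ∈ Finset.range (d+1), (r j).denom, ?_, ?_, ?_⟩
  · exact mul_ne_zero (RatFunc.num_ne_zero hrd) (Finset.prod_ne_zero_iff.2 fun j _ => RatFunc.denom_ne_zero _)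
  · exact (Finset.prod_ne_zero_iff.2 fun j _ => RatFunc.denom_ne_zero _)
  · intro x y w hD h
    have hD' : ∀ k ∈ Finset.range (d+1), (r k).denom.eval x ≠ 0 := by
      rw [Polynomial.eval_prod] at hD
      exact Finset.prod_ne_zero_iff.1 hD
    rw [h fun k hk => hD' k (by simp; omega), Finset.mul_sum]
    refine Finset.sum_congr rfl fun k hk => ?_
    rw [← Finset.mul_prod_erase _ _ hk, Polynomial.eval_mul, Polynomial.eval_mul, RatFunc.eval,
      ← Polynomial.eval, ← Polynomial.eval]
    have := hD' k hk
    field_simp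

lemma exB (y : ℂ → ℂ) (hy : ∀ x, MeromorphicAt y x) (S : Set ℂ) (hS : IsCompact S) :
    ∃ B : Polynomial ℂ, B ≠ 0 ∧ ∀ x ∈ S, 0 ≤ meromorphicOrderAt (fun z => B.eval z * y z) x := by
  have hPan : ∀ (B : Polynomial ℂ) (z : ℂ), AnalyticAt ℂ (fun z => B.eval z) z := fun B z =>
    B.differentiable.analyticAt z
  have hmul : ∀ (A B : Polynomial ℂ) (z : ℂ), 0 ≤ meromorphicOrderAt (fun z => B.eval z * y z) z → 
      0 ≤ meromorphicOrderAt (fun z => (A * B).eval z * y z) z := by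
    intro A B z h
    have he : (fun z => (A * B).eval z * y z) = (fun z => A.eval z) * (fun z => B.eval z * y z) := by
      ext z; simp [mul_assoc]
    have hBy : MeromorphicAt (fun z => B.eval z * y z) z := (hPan B z).meromorphicAt.mul (hy z)
    rw [he, meromorphicOrderAt_mul (hPan A z).meromorphicAt hBy]
    exact add_nonneg (hPan A z).meromorphicOrderAt_nonneg h
  refine hS.induction_on (p := fun S => ∃ B : Polynomial ℂ, B ≠ 0 ∧ ∀ x ∈ S, 0 ≤ meromorphicOrderAt (fun z => B.eval z * y z) x) ⟨1, one_ne_zero, by simp⟩ ?_ ?_ ?_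
  · rintro s t hst ⟨B, hB, h⟩
    exact ⟨B, hB, fun x hx => h x (hst hx)⟩
  · rintro s t ⟨A, hA, hs⟩ ⟨B, hB, ht⟩
    refine ⟨A * B, mul_ne_zero hA hB, ?_⟩
    rintro x (hx | hx)
    · rw [mul_comm]; exact hmul _ _ _ (hs x hx)
    · exact hmul _ _ _ (ht x hx)
  · intro x _
    obtain ⟨n, hn⟩ := hy x
    refine ⟨{z | AnalyticAt ℂ (fun z => (z - x) ^ n • y z) z}, mem_nhdsWithin_of_mem_nhds hn.eventually_analyticAt,
      (Polynomial.X - Polynomial.C x) ^ n, pow_ne_zero _ (Polynomial.X_sub_C_ne_zero x), ?_⟩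
    intro z hz
    simpa using AnalyticAt.meromorphicOrderAt_nonneg hz

/-- **Yosida's theorem (1932).**  Let `m ≥ 1` and let
`R(x, y) = ∑_{k ≤ d} r k (x) · y ^ k` with rational-function coefficients
`r k ∈ ℂ(x)` and `r d ≠ 0`, so `deg_y R = d`.  If the ODE `(y')^m = R(x, y)` has a
transcendental meromorphic solution — a function meromorphic on all of `ℂ`, not a
rational function, satisfying the equation at every point where it is analytic and all
coefficients are finite — then `d ≤ 2 m`. -/
theorem yosida
    (m : ℕ) (hm : 1 ≤ m) (d : ℕ)
    (r : ℕ → RatFunc ℂ) (hrd : r d ≠ 0) (hrtop : ∀ k, d < k → r k = 0)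
    (y : ℂ → ℂ) (hy : MeromorphicOn y Set.univ)
    (htrans : ¬ ∃ A B : Polynomial ℂ, B ≠ 0 ∧
      ∀ x : ℂ, AnalyticAt ℂ y x → y x * B.eval x = A.eval x)
    (hode : ∀ x : ℂ, AnalyticAt ℂ y x → (∀ k, k ≤ d → (r k).denom.eval x ≠ 0) →
      (deriv y x) ^ m =
        ∑ k ∈ Finset.range (d + 1), RatFunc.eval (RingHom.id ℂ) x (r k) * y x ^ k) :
    d ≤ 2 * m := by
  by_contra! hd
  apply htrans
  have hy' : ∀ x, MeromorphicAt y x := fun x => hy x trivial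
  obtain ⟨p, D, hp, hD, hpD⟩ := clearDen m d r hrd
  obtain ⟨K, c, hc, hA⟩ := lemA m d (by omega) p D hp
  have hode' : ∀ x, ∀ᶠ z in 𝓝[≠] x, D.eval z * deriv y z ^ m =
      ∑ k ∈ Finset.range (d+1), (p k).eval z * y z ^ k := by
    intro x
    have hroot : ∀ᶠ z in 𝓝[≠] x, D.eval z ≠ 0 := 
      (Polynomial.eventually_cofinite_not_isRoot hD).filter_mono (nhdsNE_le_cofinite x)
    filter_upwards [hroot, (hy' x).eventually_analyticAt] with z hz ha
    exact hpD z _ _ hz (hode z ha)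
  have hN : ∀ᶠ x in cobounded ℂ, max 1 (1 / c) ≤ ‖x‖ :=
    tendsto_norm_cobounded_atTop.eventually_ge_atTop _
  have hall := hA.and hN
  rw [← comap_norm_atTop, eventually_comap, eventually_atTop] at hall
  obtain ⟨R0, hR0⟩ := hall
  let R := max R0 0 + 1
  have hRR : ∀ z : ℂ, R ≤ ‖z‖ → R0 < ‖z‖ := fun z hz => by
    have := le_max_left R0 0
    simp only [R] at hz; linarith
  have hR1 : 1 ≤ R := by simp [R]
  have hpole : ∀ x, R ≤ ‖x‖ → 0 ≤ meromorphicOrderAt y x := by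
    intro x hx
    refine lemE y x K m d c hc hd (hy' x) ?_
    have hnear : ∀ᶠ z in 𝓝[≠] x, R0 < ‖z‖ := 
      (continuous_norm.continuousAt.eventually_const_lt (hRR x hx)).filter_mono nhdsWithin_le_nhds
    filter_upwards [hode' x, hnear] with z hz hn hb
    exact (hR0 ‖z‖ hn.le z rfl).1 _ _ hb hz
  let Y := toMeromorphicNFOn y Set.univ
  have hYnf : ∀ x, MeromorphicNFAt Y x := fun x => meromorphicNFOn_toMeromorphicNFOn y Set.univ (Set.mem_univ x)
  have hYy : ∀ x, y =ᶠ[𝓝[≠] x] Y := fun x => hy.toMeromorphicNFOn_eq_self_on_nhdsNE trivial |>.symm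
  have hYan : ∀ x, R ≤ ‖x‖ → AnalyticAt ℂ Y x := fun x hx => by
    rw [← (hYnf x).meromorphicOrderAt_nonneg_iff_analyticAt, ← meromorphicOrderAt_congr (hYy x)]
    exact hpole x hx
  have hYode : ∀ x, R ≤ ‖x‖ → D.eval x * deriv Y x ^ m =
      ∑ k ∈ Finset.range (d+1), (p k).eval x * Y x ^ k := by
    intro x hx
    have ha := hYan x hx
    have h1 : ContinuousAt Y x := ha.continuousAt
    have h2 : ContinuousAt (deriv Y) x := ha.deriv.continuousAt
    have hl : ContinuousAt (fun z => D.eval z * deriv Y z ^ m) x :=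
      D.continuous.continuousAt.mul (h2.pow m)
    have hr : ContinuousAt (fun z => ∑ k ∈ Finset.range (d+1), (p k).eval z * Y z ^ k) x :=
      tendsto_finsetSum _ fun k _ => ((p k).continuous.continuousAt.mul (h1.pow k))
    refine tendsto_nhds_unique_of_eventuallyEq (hl.tendsto.mono_left nhdsWithin_le_nhds)
      (hr.tendsto.mono_left nhdsWithin_le_nhds) (l := 𝓝[≠] x) ?_
    filter_upwards [hode' x, eventually_nhdsNE_eventually_nhds_iff.2 (hYy x)] with z hz he
    have he' : y =ᶠ[𝓝 z] Y := he
    rw [← he'.deriv_eq, ← he'.eq_of_nhds]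
    exact hz
  have hbound := lemB Y R (K+1) hR1 hYan (by
    intro z hz hb
    obtain ⟨h1, h2⟩ := hR0 ‖z‖ (hRR z hz).le z rfl
    have h3 := h1 _ _ hb (hYode z hz)
    have hz1 : 1 ≤ ‖z‖ := (le_max_left _ _).trans h2
    have hz2 : 1 ≤ c * ‖z‖ := by
      have := (le_max_right _ _).trans h2
      rwa [div_le_iff₀' hc] at this
    have hY1 : 1 ≤ ‖Y z‖ := (one_le_pow₀ hz1).trans hb
    have h4 : ‖z‖ ^ K * (‖Y z‖ ^ 2) ^ m ≤ ‖z‖ ^ K * ‖deriv Y z‖ ^ m := by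
      refine le_trans ?_ h3
      calc ‖z‖ ^ K * (‖Y z‖ ^ 2) ^ m ≤ (c * ‖z‖) * ‖z‖ ^ K * (‖Y z‖ ^ 2) ^ m := by
            gcongr
            exact le_mul_of_one_le_left (by positivity) hz2
        _ = c * ‖z‖ ^ (K+1) * ‖Y z‖ ^ (2*m) := by rw [← pow_mul]; ring
        _ ≤ c * ‖Y z‖ * ‖Y z‖ ^ (2*m) := by gcongr
        _ = c * ‖Y z‖ ^ (2*m+1) := by ring
        _ ≤ c * ‖Y z‖ ^ d := by gcongr; exact hd
    have h5 := le_of_mul_le_mul_left h4 (by positivity)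
    exact (pow_le_pow_iff_left₀ (by positivity) (by positivity) (by omega)).1 h5)
  obtain ⟨B, hB, hBS⟩ := exB y hy' (Metric.closedBall 0 R) (isCompact_closedBall 0 R)
  have hPan : ∀ (z : ℂ), AnalyticAt ℂ (fun z => B.eval z) z := fun z => B.differentiable.analyticAt z
  have hBy : MeromorphicOn (fun z => B.eval z * y z) Set.univ := fun x _ =>
    (hPan x).meromorphicAt.mul (hy' x)
  let f := toMeromorphicNFOn (fun z => B.eval z * y z) Set.univ
  have hfe : ∀ x, (fun z => B.eval z * y z) =ᶠ[𝓝[≠] x] f := fun x => hBy.toMeromorphicNFOn_eq_self_on_nhdsNE trivial |>.symm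
  have hfan : ∀ x, AnalyticAt ℂ f x := by
    intro x
    rw [← (meromorphicNFOn_toMeromorphicNFOn _ Set.univ (Set.mem_univ x)).meromorphicOrderAt_nonneg_iff_analyticAt, ← meromorphicOrderAt_congr (hfe x)]
    by_cases hx : ‖x‖ ≤ R
    · exact hBS x (by simpa using hx)
    · have := meromorphicOrderAt_mul (hPan x).meromorphicAt (hy' x)
      refine le_of_le_of_eq ?_ this.symm
      exact add_nonneg (hPan x).meromorphicOrderAt_nonneg (hpole x (not_le.1 hx).le)
  have huniq : ∀ (g : ℂ → ℂ) (x : ℂ), AnalyticAt ℂ g x → g =ᶠ[𝓝[≠] x] y → f x = B.eval x * g x := by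
    intro g x hg he
    have h1 : (fun z => B.eval z * g z) =ᶠ[𝓝[≠] x] f := by
      filter_upwards [hfe x, he] with z h1 h2
      rw [← h1, h2]
    exact (tendsto_nhds_unique_of_eventuallyEq (((hPan x).mul hg).continuousAt.tendsto.mono_left nhdsWithin_le_nhds)
      ((hfan x).continuousAt.tendsto.mono_left nhdsWithin_le_nhds) (l := 𝓝[≠] x) h1).symm
  obtain ⟨A, hA⟩ := lemC f (fun x => (hfan x).differentiableAt) (B.natDegree + 1 + (2 * (K+1) + 1)) (by
    have h1 := polyUpper B _ (Nat.lt_succ_self _)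
    have h2 : ∀ᶠ x in cobounded ℂ, max 4 (R + 1) ≤ ‖x‖ :=
      tendsto_norm_cobounded_atTop.eventually_ge_atTop _
    filter_upwards [h1, h2] with x h1 h2
    have h3 := (le_max_right _ _).trans h2
    have h4 := (le_max_left _ _).trans h2
    rw [huniq Y x (hYan x (by linarith)) (hYy x).symm, norm_mul, pow_add]
    have h5 : ‖Y x‖ ≤ ‖x‖ ^ (2 * (K+1) + 1) := by
      refine (hbound x h3).trans ?_
      have : ‖x‖ + 1 ≤ ‖x‖ ^ 2 := by nlinarith
      calc 4 * (‖x‖ + 1) ^ (K+1) ≤ ‖x‖ * (‖x‖ ^ 2) ^ (K+1) := by gcongr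
        _ = _ := by rw [← pow_mul, pow_succ, mul_comm]
    gcongr)
  refine ⟨A, B, hB, fun x hx => ?_⟩
  rw [← hA x, huniq y x hx (EventuallyEq.refl _ _), mul_comm]
end
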